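/- arXiv:2603.04316 — 2 statements merged into one kernel-verified Lean document; each statement's English description precedes it below -/
import Mathlib

section
/- For real ξ with |ξ| < k and k > 0, the Fourier-type integral ∫_ℝ (i/4) H₀⁽¹⁾(k|x|) e^{iξx} dx equals i / (2√(k² − ξ²)), where H₀⁽¹⁾ is the Hankel function of the first kind of order zero. -/
open Real Complex Filter MeasureTheory intervalIntegral


lemma near_zero (f f1 f2 : ℝ → ℝ) (a b C δ : ℝ) (hδ : 0 < δ)
    (h1 : ∀ x, 0 < x → HasDerivAt f (f1 x) x) (h2 : ∀ x, 0 < x → HasDerivAt f1 (f2 x) x)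
    (hC : ∀ x, 0 < x → x < δ → |x * f2 x + f1 x| ≤ C)
    (hlim : Tendsto (fun x => f x - a * Real.log x) (nhdsWithin 0 (Set.Ioi 0)) (nhds b)) :
    Tendsto (fun x => x * f1 x - a) (nhdsWithin 0 (Set.Ioi 0)) (nhds 0) ∧
    Tendsto (fun x => (x * f1 x - a) * Real.log x) (nhdsWithin 0 (Set.Ioi 0)) (nhds 0) := by
  have hC0 : 0 ≤ C := le_trans (abs_nonneg _) (hC (δ/2) (by linarith) (by linarith))
  have hmem : ∀ᶠ x in nhdsWithin (0:ℝ) (Set.Ioi 0), x ∈ Set.Ioo 0 δ := Ioo_mem_nhdsGT hδ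
  have key : ∀ (q q1 : ℝ → ℝ), (∀ x, 0 < x → HasDerivAt q (q1 x) x) →
      (∀ x, 0 < x → x < δ → |q1 x| ≤ C) →
      ∃ q0, Tendsto q (nhdsWithin 0 (Set.Ioi 0)) (nhds q0) ∧
        ∀ x, 0 < x → x < δ → |q x - q0| ≤ C * x := by
    intro q q1 hq hb
    have hL : LipschitzOnWith ⟨C, hC0⟩ q (Set.Ioo 0 δ) := by
      apply (convex_Ioo 0 δ).lipschitzOnWith_of_nnnorm_hasDerivWithin_le
        (f' := q1) (fun x hx => (hq x hx.1).hasDerivWithinAt)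
      intro x hx
      exact hb x hx.1 hx.2
    obtain ⟨g, hg, hge⟩ := hL.extend_real
    refine ⟨g 0, ?_, ?_⟩
    · have := (hg.continuous.tendsto 0).mono_left (nhdsWithin_le_nhds (s := Set.Ioi 0))
      refine this.congr' ?_
      filter_upwards [hmem] with x hx using (hge hx).symm
    · intro x hx hx'
      rw [hge ⟨hx, hx'⟩]
      have := hg.dist_le_mul x 0
      simp only [Real.dist_eq, sub_zero, abs_of_pos hx] at this
      exact this
  obtain ⟨v0, hv, hvb⟩ := key (fun x => x * f1 x) (fun x => x * f2 x + f1 x)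
    (fun x hx => by
      have := (hasDerivAt_id x).mul (h2 x hx)
      refine this.congr_deriv ?_
      simp; ring) hC
  obtain ⟨q0, hq, -⟩ := key (fun x => f x - v0 * Real.log x) (fun x => f1 x - v0 * x⁻¹)
    (fun x hx => (h1 x hx).sub ((Real.hasDerivAt_log hx.ne').const_mul v0))
    (fun x hx hx' => by
      have h := hvb x hx hx'
      have e : f1 x - v0 * x⁻¹ = (x * f1 x - v0) / x := by field_simp
      rw [e, abs_div, abs_of_pos hx, div_le_iff₀ hx]; exact h)
  have hav : v0 = a := by
    by_contra hne
    have h3 := hlim.sub hq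
    have h4 : Tendsto (fun x => (v0 - a) * Real.log x) (nhdsWithin 0 (Set.Ioi 0)) (nhds (b - q0)) := by
      refine h3.congr fun x => ?_
      ring
    have h5 : Tendsto Real.log (nhdsWithin 0 (Set.Ioi 0)) (nhds ((v0 - a)⁻¹ * (b - q0))) := by
      refine (h4.const_mul (v0 - a)⁻¹).congr fun x => ?_
      have : v0 - a ≠ 0 := sub_ne_zero.2 hne
      field_simp
    exact not_tendsto_nhds_of_tendsto_atBot Real.tendsto_log_nhdsGT_zero _ h5
  subst hav
  refine ⟨by simpa using hv.sub_const v0, ?_⟩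
  have hxl : Tendsto (fun x => C * |x * Real.log x|) (nhdsWithin 0 (Set.Ioi 0)) (nhds 0) := by
    have := (Real.continuous_mul_log.tendsto 0).mono_left (nhdsWithin_le_nhds (s := Set.Ioi 0))
    simpa using (this.abs.const_mul C)
  refine squeeze_zero_norm' ?_ hxl
  filter_upwards [hmem] with x hx
  have h := hvb x hx.1 hx.2
  rw [Real.norm_eq_abs, abs_mul, abs_mul, abs_of_pos hx.1, ← mul_assoc]
  exact mul_le_mul_of_nonneg_right h (abs_nonneg _)

lemma decay (f f1 f2 : ℝ → ℝ)
    (h1 : ∀ x, 0 < x → HasDerivAt f (f1 x) x) (h2 : ∀ x, 0 < x → HasDerivAt f1 (f2 x) x)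
    (ode : ∀ x, 0 < x → x * f2 x + f1 x + x * f x = 0) :
    Tendsto f atTop (nhds 0) ∧ Tendsto f1 atTop (nhds 0) := by
  set E : ℝ → ℝ := fun x => f1 x ^ 2 + f x ^ 2 with hE
  have hf2 : ∀ x, 0 < x → f2 x = - f x - f1 x / x := by
    intro x hx
    have := ode x hx
    field_simp
    linarith
  have hEd : ∀ x, 0 < x → HasDerivAt E (-2 * f1 x ^ 2 / x) x := by
    intro x hx
    refine (((h2 x hx).pow 2).add ((h1 x hx).pow 2)).congr_deriv ?_
    rw [hf2 x hx]; field_simp; simp; ring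
  have hanti : ∀ x, 1 ≤ x → E x ≤ E 1 := by
    have : AntitoneOn E (Set.Ici 1) := by
      apply antitoneOn_of_deriv_nonpos (convex_Ici 1)
      · intro x hx
        exact (hEd x (lt_of_lt_of_le one_pos hx)).continuousAt.continuousWithinAt
      · intro x hx
        rw [interior_Ici] at hx
        exact (hEd x (lt_trans one_pos hx)).differentiableAt.differentiableWithinAt
      · intro x hx
        rw [interior_Ici] at hx
        have hx0 : 0 < x := lt_trans one_pos hx
        rw [(hEd x hx0).deriv]
        apply div_nonpos_of_nonpos_of_nonneg _ hx0.le
        nlinarith [sq_nonneg (f1 x)]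
    intro x hx
    exact this (Set.mem_Ici.2 le_rfl) hx hx
  set W : ℝ → ℝ := fun x => x * E x + f x * f1 x - E 1 / 2 * Real.log x with hW
  have hWd : ∀ x, 0 < x → HasDerivAt W (-(f x * f1 x) / x - E 1 / 2 * x⁻¹) x := by
    intro x hx
    refine ((((hasDerivAt_id x).mul (hEd x hx)).add ((h1 x hx).mul (h2 x hx))).sub
      ((Real.hasDerivAt_log hx.ne').const_mul (E 1 / 2))).congr_deriv ?_
    rw [hf2 x hx]; simp [hE]; field_simp; ring
  have hWanti : ∀ x, 1 ≤ x → W x ≤ W 1 := by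
    have : AntitoneOn W (Set.Ici 1) := by
      apply antitoneOn_of_deriv_nonpos (convex_Ici 1)
      · intro x hx
        exact (hWd x (lt_of_lt_of_le one_pos hx)).continuousAt.continuousWithinAt
      · intro x hx
        rw [interior_Ici] at hx
        exact (hWd x (lt_trans one_pos hx)).differentiableAt.differentiableWithinAt
      · intro x hx
        rw [interior_Ici] at hx
        have hx0 : 0 < x := lt_trans one_pos hx
        rw [(hWd x hx0).deriv]
        have e : -(f x * f1 x) / x - E 1 / 2 * x⁻¹ = (-(f x * f1 x) - E 1 / 2) / x := by
          field_simp
        rw [e]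
        apply div_nonpos_of_nonpos_of_nonneg _ hx0.le
        have := hanti x (le_of_lt hx)
        simp only [hE] at this ⊢
        nlinarith [sq_nonneg (f1 x + f x)]
    intro x hx
    exact this (Set.mem_Ici.2 le_rfl) hx hx
  have hEb : ∀ x, 1 ≤ x → E x ≤ 2 * W 1 * x⁻¹ + E 1 * (Real.log x / x) := by
    intro x hx
    have hx0 : 0 < x := lt_of_lt_of_le one_pos hx
    have h := hWanti x hx
    have e : 2 * W 1 * x⁻¹ + E 1 * (Real.log x / x) = (2 * W 1 + E 1 * Real.log x) / x := by
      field_simp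
    rw [e, le_div_iff₀ hx0]
    have h3 : W x = x * E x + f x * f1 x - E 1 / 2 * Real.log x := rfl
    have h4 : E x = f1 x ^ 2 + f x ^ 2 := rfl
    have h5 : E x ≤ x * E x := le_mul_of_one_le_left (by rw [h4]; positivity) hx
    nlinarith [sq_nonneg (f1 x + f x)]
  have hE0 : Tendsto E atTop (nhds 0) := by
    have hl : Tendsto (fun x : ℝ => Real.log x / x) atTop (nhds 0) := by
      simpa using Real.isLittleO_log_id_atTop.tendsto_div_nhds_zero
    have hr := (tendsto_inv_atTop_zero.const_mul (2 * W 1)).add (hl.const_mul (E 1))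
    simp only [mul_zero, add_zero] at hr
    refine squeeze_zero' ?_ ?_ hr
    · exact Eventually.of_forall fun x => by positivity
    · filter_upwards [eventually_ge_atTop 1] with x hx using hEb x hx
  have hs : Tendsto (fun x => Real.sqrt (E x)) atTop (nhds 0) := by
    simpa using hE0.sqrt
  constructor
  · refine squeeze_zero_norm (fun x => ?_) hs
    apply Real.le_sqrt_of_sq_le
    simp only [Real.norm_eq_abs, sq_abs, hE]; nlinarith [sq_nonneg (f1 x)]
  · refine squeeze_zero_norm (fun x => ?_) hs
    apply Real.le_sqrt_of_sq_le
    simp only [Real.norm_eq_abs, sq_abs, hE]; nlinarith [sq_nonneg (f x)]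

lemma near_zero' (f f1 f2 c : ℝ → ℝ) (a b : ℝ)
    (h1 : ∀ x, 0 < x → HasDerivAt f (f1 x) x) (h2 : ∀ x, 0 < x → HasDerivAt f1 (f2 x) x)
    (hc : Continuous c) (ode : ∀ x, 0 < x → x * f2 x + f1 x + x * f x = c x)
    (hlim : Tendsto (fun x => f x - a * Real.log x) (nhdsWithin 0 (Set.Ioi 0)) (nhds b)) :
    Tendsto (fun x => x * f1 x - a) (nhdsWithin 0 (Set.Ioi 0)) (nhds 0) ∧
    Tendsto (fun x => (x * f1 x - a) * Real.log x) (nhdsWithin 0 (Set.Ioi 0)) (nhds 0) := by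
  have hx0 : Tendsto (fun x : ℝ => x) (nhdsWithin 0 (Set.Ioi 0)) (nhds 0) :=
    tendsto_id.mono_left nhdsWithin_le_nhds
  have hxl : Tendsto (fun x => x * Real.log x) (nhdsWithin 0 (Set.Ioi 0)) (nhds 0) := by
    have := (Real.continuous_mul_log.tendsto 0).mono_left (nhdsWithin_le_nhds (s := Set.Ioi 0))
    simpa using this
  have hxf : Tendsto (fun x => c x - (x * (f x - a * Real.log x) + a * (x * Real.log x)))
      (nhdsWithin 0 (Set.Ioi 0)) (nhds (c 0)) := by
    have := ((hc.tendsto 0).mono_left (nhdsWithin_le_nhds (s := Set.Ioi 0))).sub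
      ((hx0.mul hlim).add (hxl.const_mul a))
    simpa using this
  have hb := hxf.abs.eventually (gt_mem_nhds (lt_add_one |c 0|))
  rw [eventually_nhdsWithin_iff] at hb
  obtain ⟨δ, hδ, hb⟩ := Metric.eventually_nhds_iff.1 hb
  refine near_zero f f1 f2 a b (|c 0| + 1) δ hδ h1 h2 (fun x hx hxδ => ?_) hlim
  have := hb (y := x) (by simpa [abs_of_pos hx] using hxδ) hx
  refine le_trans (le_of_eq ?_) this.le
  rw [← ode x hx]
  congr 1; ring

lemma integrable_near (f : ℝ → ℝ) (a b : ℝ) (hf : ∀ x, 0 < x → ContinuousAt f x)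
    (hlim : Tendsto (fun x => f x - a * Real.log x) (nhdsWithin 0 (Set.Ioi 0)) (nhds b))
    (T : ℝ) (hT : 0 < T) : IntervalIntegrable f volume 0 T := by
  set r : ℝ → ℝ := Function.update (fun x => f x - a * Real.log x) 0 b with hr
  have hrc : ContinuousOn r (Set.Icc 0 T) := by
    intro x hx
    rcases hx.1.eq_or_lt with rfl | h0
    · rw [hr, continuousWithinAt_update_same]
      refine hlim.mono_left (nhdsWithin_mono _ ?_)
      rintro y ⟨hy, hy'⟩
      exact lt_of_le_of_ne hy.1 (Ne.symm hy')
    · apply ContinuousAt.continuousWithinAt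
      rw [hr, continuousAt_update_of_ne h0.ne']
      exact (hf x h0).sub ((Real.continuousAt_log h0.ne').const_mul a)
  have h1 : IntervalIntegrable r volume 0 T := by
    apply ContinuousOn.intervalIntegrable
    rwa [Set.uIcc_of_le hT.le]
  have h2 : IntervalIntegrable (fun x => a * Real.log x) volume 0 T :=
    intervalIntegral.intervalIntegrable_log'.const_mul a
  refine (h1.add h2).congr ?_
  intro x hx
  rw [Set.uIoc_of_le hT.le] at hx
  simp [hr, Function.update_of_ne hx.1.ne']

lemma pairing (f f1 f2 G G1 G2 c : ℝ → ℝ) (a b d K : ℝ)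
    (h1 : ∀ x, 0 < x → HasDerivAt f (f1 x) x) (h2 : ∀ x, 0 < x → HasDerivAt f1 (f2 x) x)
    (ode : ∀ x, 0 < x → x * f2 x + f1 x + x * f x = 0)
    (hlim : Tendsto (fun x => f x - a * Real.log x) (nhdsWithin 0 (Set.Ioi 0)) (nhds b))
    (g1 : ∀ x, 0 < x → HasDerivAt G (G1 x) x) (g2 : ∀ x, 0 < x → HasDerivAt G1 (G2 x) x)
    (hc : Continuous c) (gode : ∀ x, 0 < x → x * G2 x + G1 x + x * G x = c x)
    (glim : Tendsto (fun x => G x + Real.log x) (nhdsWithin 0 (Set.Ioi 0)) (nhds d))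
    (gK : ∀ x, 1 ≤ x → |x * G x| ≤ K) (gK1 : ∀ x, 1 ≤ x → |x * G1 x| ≤ K) :
    Tendsto (fun T => ∫ x in (0:ℝ)..T, f x * c x) atTop (nhds (b + a * d)) := by
  obtain ⟨f0, f10⟩ := decay f f1 f2 h1 h2 ode
  have glim' : Tendsto (fun x => G x - (-1) * Real.log x) (nhdsWithin 0 (Set.Ioi 0)) (nhds d) := by
    simpa using glim
  obtain ⟨A1, A2⟩ := near_zero' f f1 f2 (fun _ => 0) a b h1 h2 continuous_const ode hlim
  obtain ⟨B1, B2⟩ := near_zero' G G1 G2 c (-1) d g1 g2 hc gode glim'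
  set P : ℝ → ℝ := fun x => f x * (x * G1 x) - (x * f1 x) * G x with hP
  have hPd : ∀ x, 0 < x → HasDerivAt P (f x * c x) x := by
    intro x hx
    refine (((h1 x hx).mul ((hasDerivAt_id x).mul (g2 x hx))).sub
      (((hasDerivAt_id x).mul (h2 x hx)).mul (g1 x hx))).congr_deriv ?_
    have e1 := ode x hx
    rw [← gode x hx]
    simp only [id, Pi.mul_apply]
    linear_combination (- G x) * e1
  have hP0 : Tendsto P (nhdsWithin 0 (Set.Ioi 0)) (nhds (-(b + a * d))) := by
    have h := ((((hlim.mul B1).add (B2.const_mul a)).sub (hlim.add (glim.const_mul a))).sub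
      (A1.mul glim')).add A2
    simp only [mul_zero, zero_mul, add_zero, zero_sub, sub_zero] at h
    refine h.congr fun x => ?_
    simp only [hP]
    ring
  have hPT : Tendsto P atTop (nhds 0) := by
    have h := (f0.abs.mul_const K).add (f10.abs.mul_const K)
    simp only [abs_zero, zero_mul, add_zero] at h
    refine squeeze_zero_norm' ?_ h
    filter_upwards [eventually_ge_atTop 1] with x hx
    have e : P x = f x * (x * G1 x) - f1 x * (x * G x) := by simp only [hP]; ring
    rw [e, Real.norm_eq_abs]
    refine (abs_sub _ _).trans ?_
    rw [abs_mul, abs_mul (f1 x)]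
    gcongr
    · exact gK1 x hx
    · exact gK x hx
  have hI : ∀ T, 0 < T → ∫ x in (0:ℝ)..T, f x * c x = P T - (-(b + a * d)) := by
    intro T hT
    refine integral_eq_sub_of_hasDerivAt_of_tendsto hT (fun x hx => hPd x hx.1) ?_ hP0
      ((hPd T hT).continuousAt.tendsto.mono_left nhdsWithin_le_nhds)
    exact (integrable_near f a b (fun x hx => (h1 x hx).continuousAt) hlim T hT).mul_continuousOn
      hc.continuousOn
  have := hPT.sub_const (-(b + a * d))
  rw [zero_sub, neg_neg] at this
  refine this.congr' ?_
  filter_upwards [eventually_gt_atTop 0] with T hT using (hI T hT).symm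

lemma int_pow_exp (n : ℕ) (x : ℝ) (hx : 0 < x) :
    IntegrableOn (fun p : ℝ => p ^ n * Real.exp (-(x * p))) (Set.Ioi 0) := by
  have := integrableOn_rpow_mul_exp_neg_mul_rpow (p := 1) (s := n) (b := x)
    (by have : (0:ℝ) ≤ n := Nat.cast_nonneg n
        linarith) one_pos hx
  refine this.congr_fun (fun p hp => ?_) measurableSet_Ioi
  simp

lemma integral_pow_exp (n : ℕ) (x : ℝ) (hx : 0 < x) :
    ∫ p in Set.Ioi (0:ℝ), p ^ n * Real.exp (-(x * p)) = (1 / x) ^ (n + 1) * n.factorial := by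
  have := Real.integral_rpow_mul_exp_neg_mul_Ioi (a := n + 1) (r := x) (by positivity) hx
  rw [Real.Gamma_nat_eq_factorial] at this
  rw [← Real.rpow_natCast (1 / x) (n + 1), Nat.cast_add, Nat.cast_one, ← this]
  refine setIntegral_congr_fun measurableSet_Ioi (fun p hp => ?_)
  simp

lemma tendsto_pow_exp (n : ℕ) (x : ℝ) (hx : 0 < x) :
    Tendsto (fun p : ℝ => p ^ n * Real.exp (-(x * p))) atTop (nhds 0) := by
  have := tendsto_rpow_mul_exp_neg_mul_atTop_nhds_zero n x hx
  refine this.congr fun p => ?_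
  simp

lemma one_le_sq (p : ℝ) : 1 ≤ Real.sqrt (1 + p ^ 2) :=
  Real.one_le_sqrt.2 (by nlinarith [sq_nonneg p])

noncomputable def LL (n : ℕ) (x : ℝ) : ℝ :=
  ∫ p in Set.Ioi (0:ℝ), p ^ n * Real.exp (-(x * p)) / Real.sqrt (1 + p ^ 2)

lemma cont_LL (n : ℕ) (x : ℝ) :
    Continuous (fun p : ℝ => p ^ n * Real.exp (-(x * p)) / Real.sqrt (1 + p ^ 2)) := by
  apply Continuous.div (by fun_prop) (by fun_prop)
  intro p
  have := one_le_sq p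
  linarith

lemma int_LL (n : ℕ) (x : ℝ) (hx : 0 < x) :
    IntegrableOn (fun p : ℝ => p ^ n * Real.exp (-(x * p)) / Real.sqrt (1 + p ^ 2)) (Set.Ioi 0) := by
  refine (int_pow_exp n x hx).mono' (cont_LL n x).aestronglyMeasurable ?_
  filter_upwards [ae_restrict_mem measurableSet_Ioi] with p hp
  have hp : 0 < p := hp
  rw [Real.norm_eq_abs, abs_of_nonneg (by positivity)]
  exact div_le_self (by positivity) (one_le_sq p)

lemma LL_nonneg (n : ℕ) (x : ℝ) : 0 ≤ LL n x := by
  refine setIntegral_nonneg measurableSet_Ioi (fun p hp => ?_)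
  have hp : 0 < p := hp
  positivity

lemma LL_le (n : ℕ) (x : ℝ) (hx : 0 < x) : LL n x ≤ (1 / x) ^ (n + 1) * n.factorial := by
  rw [← integral_pow_exp n x hx]
  refine setIntegral_mono_on (int_LL n x hx) (int_pow_exp n x hx) measurableSet_Ioi (fun p hp => ?_)
  have hp : 0 < p := hp
  exact div_le_self (by positivity) (one_le_sq p)

lemma LL_deriv (n : ℕ) (x : ℝ) (hx : 0 < x) : HasDerivAt (LL n) (-LL (n + 1) x) x := by
  have h := hasDerivAt_integral_of_dominated_loc_of_deriv_le
    (μ := volume.restrict (Set.Ioi (0:ℝ)))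
    (F := fun x p => p ^ n * Real.exp (-(x * p)) / Real.sqrt (1 + p ^ 2))
    (F' := fun x p => -(p ^ (n + 1) * Real.exp (-(x * p)) / Real.sqrt (1 + p ^ 2)))
    (x₀ := x) (s := Set.Ioi (x / 2)) (bound := fun p => p ^ (n + 1) * Real.exp (-(x / 2 * p)))
    (Ioi_mem_nhds (by linarith))
    (Eventually.of_forall fun y => (cont_LL n y).aestronglyMeasurable)
    (int_LL n x hx) (cont_LL (n + 1) x).neg.aestronglyMeasurable
    (by
      filter_upwards [ae_restrict_mem measurableSet_Ioi] with p hp y hy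
      have hp : 0 < p := hp
      have hy : x / 2 < y := hy
      rw [norm_neg, Real.norm_eq_abs, abs_of_nonneg (by positivity)]
      refine (div_le_self (by positivity) (one_le_sq p)).trans ?_
      gcongr)
    (int_pow_exp (n + 1) (x / 2) (by linarith))
    (by
      filter_upwards with p y hy
      have h1 : HasDerivAt (fun y : ℝ => -(y * p)) (-p) y := by
        simpa using ((hasDerivAt_id y).mul_const p).fun_neg
      refine ((h1.exp.const_mul (p ^ n)).div_const _).congr_deriv ?_
      ring)
  refine h.2.congr_deriv ?_
  rw [MeasureTheory.integral_neg]; rfl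

lemma LL_ode (x : ℝ) (hx : 0 < x) : x * LL 2 x + -LL 1 x + x * LL 0 x = 1 := by
  have hd : ∀ p ∈ Set.Ici (0:ℝ), HasDerivAt (fun p => -(Real.exp (-(x * p)) * Real.sqrt (1 + p ^ 2)))
      (x * (p ^ 2 * Real.exp (-(x * p)) / Real.sqrt (1 + p ^ 2)) +
        -(p ^ 1 * Real.exp (-(x * p)) / Real.sqrt (1 + p ^ 2)) +
        x * (p ^ 0 * Real.exp (-(x * p)) / Real.sqrt (1 + p ^ 2))) p := by
    intro p _
    have h1 : HasDerivAt (fun p : ℝ => -(x * p)) (-x) p := by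
      simpa using ((hasDerivAt_id p).const_mul x).fun_neg
    have h2 : HasDerivAt (fun p : ℝ => 1 + p ^ 2) (2 * p) p := by
      simpa using ((hasDerivAt_pow 2 p).const_add 1)
    have hne : (1 + p ^ 2) ≠ 0 := by positivity
    refine (h1.exp.mul (h2.sqrt hne)).neg.congr_deriv ?_
    have hs : Real.sqrt (1 + p ^ 2) ≠ 0 := by positivity
    have hsq : Real.sqrt (1 + p ^ 2) ^ 2 = 1 + p ^ 2 := Real.sq_sqrt (by positivity)
    field_simp
    rw [hsq]; ring
  have i2 := (int_LL 2 x hx).const_mul x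
  have i1 := (int_LL 1 x hx).neg
  have i0 := (int_LL 0 x hx).const_mul x
  have hlim : Tendsto (fun p => -(Real.exp (-(x * p)) * Real.sqrt (1 + p ^ 2))) atTop (nhds 0) := by
    have h := (tendsto_pow_exp 0 x hx).add (tendsto_pow_exp 1 x hx)
    rw [add_zero] at h
    refine squeeze_zero_norm' ?_ h
    filter_upwards [eventually_ge_atTop 0] with p hp
    rw [norm_neg, Real.norm_eq_abs, abs_of_nonneg (by positivity)]
    have : Real.sqrt (1 + p ^ 2) ≤ 1 + p := Real.sqrt_le_iff.2 ⟨by positivity, by nlinarith⟩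
    have h3 := mul_le_mul_of_nonneg_left this (Real.exp_pos (-(x * p))).le
    linarith
  have h := integral_Ioi_of_hasDerivAt_of_tendsto' hd ((i2.add i1).add i0) hlim
  have e := integral_add (i2.add i1) i0
  have e' := integral_add i2 i1
  simp only [Pi.add_apply, Pi.neg_apply] at e e'
  rw [e, e', MeasureTheory.integral_const_mul, MeasureTheory.integral_neg, MeasureTheory.integral_const_mul] at h
  simpa [LL] using h

lemma int_log_exp : IntegrableOn (fun u : ℝ => Real.log u * Real.exp (-u)) (Set.Ioi 0) := by
  rw [← Set.Ioc_union_Ioi_eq_Ioi (zero_le_one (α := ℝ))]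
  apply IntegrableOn.union
  · have h : IntervalIntegrable (fun u : ℝ => Real.log u * Real.exp (-u)) volume 0 1 :=
      intervalIntegral.intervalIntegrable_log'.mul_continuousOn (by fun_prop)
    exact (intervalIntegrable_iff_integrableOn_Ioc_of_le zero_le_one).1 h
  · have h := (int_pow_exp 1 1 one_pos).mono_set (Set.Ioi_subset_Ioi (zero_le_one (α := ℝ)))
    refine h.mono' ?_ ?_
    · exact (Real.measurable_log.mul (by fun_prop)).aestronglyMeasurable
    · filter_upwards [ae_restrict_mem measurableSet_Ioi] with p hp
      have hp : 1 < p := hp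
      rw [Real.norm_eq_abs, abs_of_nonneg (mul_nonneg (Real.log_nonneg hp.le) (Real.exp_pos _).le)]
      simp only [pow_one, one_mul]
      gcongr
      have := Real.log_le_sub_one_of_pos (by linarith : 0 < p)
      linarith

lemma integral_log_exp : ∫ u in Set.Ioi (0:ℝ), Real.log u * Real.exp (-u) =
    -Real.eulerMascheroniConstant := by
  have h1 := Complex.hasDerivAt_GammaIntegral (s := 1) (by simp)
  have h2 : HasDerivAt Complex.GammaIntegral (-(Real.eulerMascheroniConstant : ℂ)) 1 := by
    refine Complex.hasDerivAt_Gamma_one.congr_of_eventuallyEq ?_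
    have : ∀ᶠ s : ℂ in nhds 1, 0 < s.re :=
      (Complex.continuous_re.tendsto 1).eventually (lt_mem_nhds (by simp))
    filter_upwards [this] with s hs using (Complex.Gamma_eq_integral hs).symm
  have h3 := h1.unique h2
  have h4 : ∫ t : ℝ in Set.Ioi 0, (t : ℂ) ^ ((1 : ℂ) - 1) * (Real.log t * Real.exp (-t)) =
      ((∫ u in Set.Ioi (0:ℝ), Real.log u * Real.exp (-u) : ℝ) : ℂ) := by
    rw [← integral_complex_ofReal]
    refine setIntegral_congr_fun measurableSet_Ioi (fun t ht => ?_)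
    simp
  rw [h4] at h3
  exact_mod_cast h3

lemma LL_arsinh (x : ℝ) (hx : 0 < x) :
    LL 0 x = ∫ u in Set.Ioi (0:ℝ), Real.exp (-u) * Real.arsinh (u / x) := by
  have hars : ∀ p : ℝ, 0 ≤ p → Real.arsinh p ≤ p := by
    intro p hp
    have := Real.self_le_sinh_iff.2 (Real.arsinh_nonneg_iff.2 hp)
    rwa [Real.sinh_arsinh] at this
  have hars0 : ∀ p : ℝ, 0 ≤ p → 0 ≤ Real.arsinh p := fun p hp => Real.arsinh_nonneg_iff.2 hp
  have hd : ∀ p ∈ Set.Ici (0:ℝ), HasDerivAt (fun p => Real.exp (-(x * p)) * Real.arsinh p)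
      (p ^ 0 * Real.exp (-(x * p)) / Real.sqrt (1 + p ^ 2) -
        x * (Real.exp (-(x * p)) * Real.arsinh p)) p := by
    intro p _
    have h1 : HasDerivAt (fun p : ℝ => -(x * p)) (-x) p := by
      simpa using ((hasDerivAt_id p).const_mul x).fun_neg
    refine (h1.exp.mul (Real.hasDerivAt_arsinh p)).congr_deriv ?_
    rw [div_eq_mul_inv]; ring
  have hb : ∀ p : ℝ, 0 ≤ p → ‖Real.exp (-(x * p)) * Real.arsinh p‖ ≤ p ^ 1 * Real.exp (-(x * p)) := by
    intro p hp
    rw [Real.norm_eq_abs, abs_of_nonneg (mul_nonneg (Real.exp_pos _).le (hars0 p hp)), pow_one,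
      mul_comm p]
    exact mul_le_mul_of_nonneg_left (hars p hp) (Real.exp_pos _).le
  have i1 : IntegrableOn (fun p => Real.exp (-(x * p)) * Real.arsinh p) (Set.Ioi 0) := by
    refine (int_pow_exp 1 x hx).mono' ?_ ?_
    · have : Continuous (fun p => Real.exp (-(x * p)) * Real.arsinh p) :=
        Continuous.mul (by fun_prop) Real.continuous_arsinh
      exact this.aestronglyMeasurable
    · filter_upwards [ae_restrict_mem measurableSet_Ioi] with p hp using hb p (le_of_lt hp)
  have hlim : Tendsto (fun p => Real.exp (-(x * p)) * Real.arsinh p) atTop (nhds 0) := by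
    refine squeeze_zero_norm' ?_ (tendsto_pow_exp 1 x hx)
    filter_upwards [eventually_ge_atTop 0] with p hp using hb p hp
  have h := integral_Ioi_of_hasDerivAt_of_tendsto' hd ((int_LL 0 x hx).sub (i1.const_mul x)) hlim
  have e := integral_sub (int_LL 0 x hx) (i1.const_mul x)
  rw [e, MeasureTheory.integral_const_mul] at h
  simp only [Real.arsinh_zero, mul_zero, sub_zero] at h
  have h5 := integral_comp_mul_left_Ioi' (fun u => Real.exp (-u) * Real.arsinh (u / x)) 0 hx
  rw [mul_zero] at h5
  rw [← h5]
  have h6 : ∀ p : ℝ, x * p / x = p := fun p => by field_simp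
  simp only [h6, smul_eq_mul]
  have h7 : LL 0 x = ∫ p in Set.Ioi (0:ℝ), p ^ 0 * Real.exp (-(x * p)) / Real.sqrt (1 + p ^ 2) := rfl
  rw [h7]
  linarith

lemma LL_lim : Tendsto (fun x => LL 0 x + Real.log x) (nhdsWithin 0 (Set.Ioi 0))
    (nhds (Real.log 2 - Real.eulerMascheroniConstant)) := by
  have hE : ∫ u in Set.Ioi (0:ℝ), Real.exp (-u) = 1 := by
    simpa using integral_pow_exp 0 1 one_pos
  have iE : IntegrableOn (fun u : ℝ => Real.exp (-u)) (Set.Ioi 0) := by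
    simpa using int_pow_exp 0 1 one_pos
  have i1 : IntegrableOn (fun u : ℝ => u * Real.exp (-u)) (Set.Ioi 0) := by
    simpa using int_pow_exp 1 1 one_pos
  have hval : ∫ u in Set.Ioi (0:ℝ), Real.exp (-u) * Real.log (u + Real.sqrt (0 ^ 2 + u ^ 2)) =
      Real.log 2 - Real.eulerMascheroniConstant := by
    have e : ∫ u in Set.Ioi (0:ℝ), Real.exp (-u) * Real.log (u + Real.sqrt (0 ^ 2 + u ^ 2)) =
        ∫ u in Set.Ioi (0:ℝ), (Real.log 2 * Real.exp (-u) + Real.log u * Real.exp (-u)) := by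
      refine setIntegral_congr_fun measurableSet_Ioi (fun u hu => ?_)
      have hu : 0 < u := hu
      have : u + Real.sqrt (0 ^ 2 + u ^ 2) = 2 * u := by
        rw [zero_pow two_ne_zero, zero_add, Real.sqrt_sq hu.le]; ring
      simp only [this]
      rw [Real.log_mul two_ne_zero hu.ne']; ring
    rw [e, integral_add (iE.const_mul _) int_log_exp, MeasureTheory.integral_const_mul, hE, integral_log_exp]
    ring
  rw [← hval]
  set bd : ℝ → ℝ := fun u => |Real.log u * Real.exp (-u)| + Real.log 2 * Real.exp (-u) +
    2 * (u * Real.exp (-u)) with hbd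
  have ibd : IntegrableOn bd (Set.Ioi 0) :=
    (int_log_exp.abs.add (iE.const_mul _)).add (i1.const_mul 2)
  have hmeas : ∀ x : ℝ, AEStronglyMeasurable
      (fun u => Real.exp (-u) * Real.log (u + Real.sqrt (x ^ 2 + u ^ 2)))
      (volume.restrict (Set.Ioi (0:ℝ))) := by
    intro x
    apply Measurable.aestronglyMeasurable
    apply Measurable.mul (by fun_prop)
    apply Real.measurable_log.comp
    fun_prop
  have hbound : ∀ x : ℝ, 0 < x → x < 1 → ∀ᵐ u ∂(volume.restrict (Set.Ioi (0:ℝ))),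
      ‖Real.exp (-u) * Real.log (u + Real.sqrt (x ^ 2 + u ^ 2))‖ ≤ bd u := by
    intro x hx hx1
    filter_upwards [ae_restrict_mem measurableSet_Ioi] with u hu
    have hu : 0 < u := hu
    have l1 : u ≤ Real.sqrt (x ^ 2 + u ^ 2) := Real.le_sqrt_of_sq_le (by nlinarith)
    have l2 : Real.sqrt (x ^ 2 + u ^ 2) ≤ 1 + u := Real.sqrt_le_iff.2 ⟨by positivity, by nlinarith⟩
    have m1 : Real.log (2 * u) ≤ Real.log (u + Real.sqrt (x ^ 2 + u ^ 2)) :=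
      Real.log_le_log (by positivity) (by linarith)
    have m2 : Real.log (u + Real.sqrt (x ^ 2 + u ^ 2)) ≤ 2 * u := by
      have := Real.log_le_sub_one_of_pos (by positivity : 0 < u + Real.sqrt (x ^ 2 + u ^ 2))
      linarith
    rw [Real.log_mul two_ne_zero hu.ne'] at m1
    have hl2 : 0 ≤ Real.log 2 := Real.log_nonneg (by norm_num)
    have m3 : |Real.log (u + Real.sqrt (x ^ 2 + u ^ 2))| ≤ |Real.log u| + Real.log 2 + 2 * u := by
      rw [abs_le]
      constructor
      · have := neg_abs_le (Real.log u); linarith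
      · have := abs_nonneg (Real.log u); linarith
    rw [Real.norm_eq_abs, abs_mul, abs_of_pos (Real.exp_pos _)]
    simp only [hbd]
    rw [abs_mul, abs_of_pos (Real.exp_pos _)]
    have := mul_le_mul_of_nonneg_left m3 (Real.exp_pos (-u)).le
    linarith
  have hI01 : ∀ᶠ x in nhdsWithin (0:ℝ) (Set.Ioi 0), x ∈ Set.Ioo (0:ℝ) 1 := Ioo_mem_nhdsGT one_pos
  have hT : Tendsto (fun x : ℝ => ∫ u in Set.Ioi (0:ℝ), Real.exp (-u) *
      Real.log (u + Real.sqrt (x ^ 2 + u ^ 2))) (nhdsWithin 0 (Set.Ioi 0))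
      (nhds (∫ u in Set.Ioi (0:ℝ), Real.exp (-u) * Real.log (u + Real.sqrt (0 ^ 2 + u ^ 2)))) := by
    refine tendsto_integral_filter_of_dominated_convergence bd
      (Eventually.of_forall fun x => hmeas x) ?_ ibd ?_
    · filter_upwards [hI01] with x hx using hbound x hx.1 hx.2
    · filter_upwards [ae_restrict_mem measurableSet_Ioi] with u hu
      have hu : 0 < u := hu
      have : ContinuousAt (fun x : ℝ => Real.exp (-u) * Real.log (u + Real.sqrt (x ^ 2 + u ^ 2))) 0 := by
        apply ContinuousAt.mul continuousAt_const
        apply ContinuousAt.log (by fun_prop)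
        positivity
      exact this.tendsto.mono_left nhdsWithin_le_nhds
  refine hT.congr' ?_
  filter_upwards [hI01] with x hx
  have hx0 : 0 < x := hx.1
  rw [LL_arsinh x hx0]
  have i3 : IntegrableOn (fun u => Real.exp (-u) * Real.log (u + Real.sqrt (x ^ 2 + u ^ 2)))
      (Set.Ioi 0) := ibd.mono' (hmeas x) (hbound x hx.1 hx.2)
  have e : ∫ u in Set.Ioi (0:ℝ), Real.exp (-u) * Real.arsinh (u / x) =
      ∫ u in Set.Ioi (0:ℝ), (Real.exp (-u) * Real.log (u + Real.sqrt (x ^ 2 + u ^ 2)) -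
        Real.log x * Real.exp (-u)) := by
    refine setIntegral_congr_fun measurableSet_Ioi (fun u hu => ?_)
    have hu : 0 < u := hu
    have h1 : u / x + Real.sqrt (1 + (u / x) ^ 2) = (u + Real.sqrt (x ^ 2 + u ^ 2)) / x := by
      have : 1 + (u / x) ^ 2 = (x ^ 2 + u ^ 2) / x ^ 2 := by field_simp
      rw [this, Real.sqrt_div (by positivity), Real.sqrt_sq hx0.le]; ring
    simp only [Real.arsinh, h1]
    rw [Real.log_div (by positivity) hx0.ne']; ring
  rw [e, integral_sub i3 (iE.const_mul _), MeasureTheory.integral_const_mul, hE]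
  ring

noncomputable def hh (A x : ℝ) : ℝ := ∫ t in (0:ℝ)..A, Real.sin (x * Real.sin t)
noncomputable def hh1 (A x : ℝ) : ℝ := ∫ t in (0:ℝ)..A, Real.sin t * Real.cos (x * Real.sin t)
noncomputable def hh2 (A x : ℝ) : ℝ :=
  ∫ t in (0:ℝ)..A, -(Real.sin t ^ 2 * Real.sin (x * Real.sin t))

lemma hh_deriv (A x : ℝ) : HasDerivAt (hh A) (hh1 A x) x := by
  refine (intervalIntegral.hasDerivAt_integral_of_dominated_loc_of_deriv_le
    (μ := volume) (F := fun x t => Real.sin (x * Real.sin t))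
    (F' := fun x t => Real.sin t * Real.cos (x * Real.sin t)) (x₀ := x) (s := Set.univ)
    (bound := fun _ => 1) univ_mem
    (Eventually.of_forall fun y => Continuous.aestronglyMeasurable (by fun_prop))
    (Continuous.intervalIntegrable (by fun_prop) _ _)
    (Continuous.aestronglyMeasurable (by fun_prop)) ?_ (by simp) ?_).2
  · refine Eventually.of_forall fun t _ y _ => ?_
    rw [Real.norm_eq_abs, abs_mul]
    exact mul_le_one₀ (Real.abs_sin_le_one _) (abs_nonneg _) (Real.abs_cos_le_one _)
  · refine Eventually.of_forall fun t _ y _ => ?_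
    have h : HasDerivAt (fun y : ℝ => y * Real.sin t) (Real.sin t) y := by
      simpa using (hasDerivAt_id y).mul_const (Real.sin t)
    exact h.sin.congr_deriv (by ring)

lemma hh1_deriv (A x : ℝ) : HasDerivAt (hh1 A) (hh2 A x) x := by
  refine (intervalIntegral.hasDerivAt_integral_of_dominated_loc_of_deriv_le
    (μ := volume) (F := fun x t => Real.sin t * Real.cos (x * Real.sin t))
    (F' := fun x t => -(Real.sin t ^ 2 * Real.sin (x * Real.sin t))) (x₀ := x) (s := Set.univ)
    (bound := fun _ => 1) univ_mem
    (Eventually.of_forall fun y => Continuous.aestronglyMeasurable (by fun_prop))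
    (Continuous.intervalIntegrable (by fun_prop) _ _)
    (Continuous.aestronglyMeasurable (by fun_prop)) ?_ (by simp) ?_).2
  · refine Eventually.of_forall fun t _ y _ => ?_
    rw [norm_neg, Real.norm_eq_abs, abs_mul]
    refine mul_le_one₀ ?_ (abs_nonneg _) (Real.abs_sin_le_one _)
    rw [abs_of_nonneg (sq_nonneg _)]
    exact Real.sin_sq_le_one t
  · refine Eventually.of_forall fun t _ y _ => ?_
    have h : HasDerivAt (fun y : ℝ => y * Real.sin t) (Real.sin t) y := by
      simpa using (hasDerivAt_id y).mul_const (Real.sin t)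
    exact (h.cos.const_mul (Real.sin t)).congr_deriv (by ring)

lemma xsin_deriv (x t : ℝ) : HasDerivAt (fun t : ℝ => x * Real.sin t) (x * Real.cos t) t :=
  (Real.hasDerivAt_sin t).const_mul x

lemma hh_ode (A x : ℝ) : x * hh2 A x + hh1 A x + x * hh A x =
    1 - Real.cos A * Real.cos (x * Real.sin A) := by
  have hd : ∀ t ∈ Set.uIcc 0 A, HasDerivAt (fun t => -(Real.cos t * Real.cos (x * Real.sin t)))
      (x * -(Real.sin t ^ 2 * Real.sin (x * Real.sin t)) + Real.sin t * Real.cos (x * Real.sin t)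
        + x * Real.sin (x * Real.sin t)) t := by
    intro t _
    refine ((Real.hasDerivAt_cos t).mul (xsin_deriv x t).cos).fun_neg.congr_deriv ?_
    have := Real.sin_sq_add_cos_sq t
    linear_combination (x * Real.sin (x * Real.sin t)) * this
  have h := integral_eq_sub_of_hasDerivAt hd (Continuous.intervalIntegrable (by fun_prop) _ _)
  rw [intervalIntegral.integral_add (Continuous.intervalIntegrable (by fun_prop) _ _)
    (Continuous.intervalIntegrable (by fun_prop) _ _),
    intervalIntegral.integral_add (Continuous.intervalIntegrable (by fun_prop) _ _)
    (Continuous.intervalIntegrable (by fun_prop) _ _),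
    intervalIntegral.integral_const_mul, intervalIntegral.integral_const_mul] at h
  simp only [Real.cos_zero, Real.sin_zero, mul_zero, mul_one] at h
  simp only [hh, hh1, hh2]
  rw [h]; ring

lemma cos_ge (A : ℝ) (hA : |A| < π / 2) (t : ℝ) (ht : t ∈ Set.uIcc 0 A) :
    0 < Real.cos A ∧ Real.cos A ≤ Real.cos t := by
  refine ⟨Real.cos_pos_of_mem_Ioo ⟨by linarith [neg_abs_le A], by linarith [le_abs_self A]⟩, ?_⟩
  rw [← Real.cos_abs A, ← Real.cos_abs t]
  apply Real.cos_le_cos_of_nonneg_of_le_pi (abs_nonneg _) (by linarith [Real.pi_pos])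
  have := Set.abs_sub_left_of_mem_uIcc ht
  simpa using this

lemma hh_bound (A x : ℝ) (hA : |A| < π / 2) :
    |x * hh A x| ≤ 1 / Real.cos A + 1 + |A| / Real.cos A ^ 2 ∧
    |x * hh1 A x| ≤ 1 / Real.cos A + 1 + |A| / Real.cos A ^ 2 := by
  have hκ : 0 < Real.cos A := (cos_ge A hA A Set.right_mem_uIcc).1
  have hne : ∀ t ∈ Set.uIcc 0 A, Real.cos t ≠ 0 := fun t ht =>
    (lt_of_lt_of_le hκ (cos_ge A hA t ht).2).ne'
  have hsub : ∀ t ∈ Set.uIoc 0 A, t ∈ Set.uIcc 0 A := fun t ht => Set.uIoc_subset_uIcc ht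
  have hq : ∀ t ∈ Set.uIoc 0 A, ∀ r : ℝ, |r| ≤ 1 → ‖r / Real.cos t ^ 2‖ ≤ 1 / Real.cos A ^ 2 := by
    intro t ht r hr
    have h1 := (cos_ge A hA t (hsub t ht)).2
    rw [Real.norm_eq_abs, abs_div, abs_of_nonneg (sq_nonneg (Real.cos t))]
    gcongr
  constructor
  · have hd : ∀ t ∈ Set.uIcc 0 A, HasDerivAt (fun t => -(Real.cos (x * Real.sin t) / Real.cos t))
        (x * Real.sin (x * Real.sin t) -
          (Real.sin t * Real.cos (x * Real.sin t)) / Real.cos t ^ 2) t := by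
      intro t ht
      have h0 := hne t ht
      refine ((xsin_deriv x t).cos.fun_div (Real.hasDerivAt_cos t) h0).fun_neg.congr_deriv ?_
      field_simp
      ring
    have c2 : IntervalIntegrable (fun t => (Real.sin t * Real.cos (x * Real.sin t)) / Real.cos t ^ 2)
        volume 0 A := by
      apply ContinuousOn.intervalIntegrable
      apply ContinuousOn.div (by fun_prop) (by fun_prop)
      intro t ht
      exact pow_ne_zero 2 (hne t ht)
    have c1 : IntervalIntegrable (fun t => x * Real.sin (x * Real.sin t)) volume 0 A :=
      Continuous.intervalIntegrable (by fun_prop) _ _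
    have h := integral_eq_sub_of_hasDerivAt hd (c1.sub c2)
    rw [intervalIntegral.integral_sub c1 c2, intervalIntegral.integral_const_mul] at h
    have hb := norm_integral_le_of_norm_le_const (fun t ht => hq t ht
      (Real.sin t * Real.cos (x * Real.sin t)) (by
        rw [abs_mul]
        exact mul_le_one₀ (Real.abs_sin_le_one _) (abs_nonneg _) (Real.abs_cos_le_one _)))
    rw [sub_zero, Real.norm_eq_abs] at hb
    simp only [Real.cos_zero, Real.sin_zero, mul_zero, div_one] at h
    have e : x * hh A x = -(Real.cos (x * Real.sin A) / Real.cos A) + 1 +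
        ∫ t in (0:ℝ)..A, (Real.sin t * Real.cos (x * Real.sin t)) / Real.cos t ^ 2 := by
      simp only [hh]; linarith
    rw [e]
    refine (abs_add_le _ _).trans (add_le_add ((abs_add_le _ _).trans (add_le_add ?_ ?_)) ?_)
    · rw [abs_neg, abs_div, abs_of_pos hκ]
      gcongr
      exact Real.abs_cos_le_one _
    · simp
    · refine hb.trans (le_of_eq ?_); ring
  · have hd : ∀ t ∈ Set.uIcc 0 A, HasDerivAt
        (fun t => Real.sin (x * Real.sin t) * Real.sin t / Real.cos t)
        (x * (Real.sin t * Real.cos (x * Real.sin t)) + (Real.sin (x * Real.sin t)) / Real.cos t ^ 2)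
        t := by
      intro t ht
      have h0 := hne t ht
      refine (((xsin_deriv x t).sin.fun_mul (Real.hasDerivAt_sin t)).fun_div
        (Real.hasDerivAt_cos t) h0).congr_deriv ?_
      have := Real.sin_sq_add_cos_sq t
      field_simp
      linear_combination (Real.sin (x * Real.sin t)) * this
    have c2 : IntervalIntegrable (fun t => (Real.sin (x * Real.sin t)) / Real.cos t ^ 2)
        volume 0 A := by
      apply ContinuousOn.intervalIntegrable
      apply ContinuousOn.div (by fun_prop) (by fun_prop)
      intro t ht
      exact pow_ne_zero 2 (hne t ht)
    have c1 : IntervalIntegrable (fun t => x * (Real.sin t * Real.cos (x * Real.sin t)))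
      volume 0 A := Continuous.intervalIntegrable (by fun_prop) _ _
    have h := integral_eq_sub_of_hasDerivAt hd (c1.add c2)
    rw [intervalIntegral.integral_add c1 c2, intervalIntegral.integral_const_mul] at h
    have hb := norm_integral_le_of_norm_le_const (fun t ht => hq t ht
      (Real.sin (x * Real.sin t)) (Real.abs_sin_le_one _))
    rw [sub_zero, Real.norm_eq_abs] at hb
    simp only [Real.sin_zero, mul_zero, zero_div, sub_zero] at h
    have e : x * hh1 A x = Real.sin (x * Real.sin A) * Real.sin A / Real.cos A -
        ∫ t in (0:ℝ)..A, (Real.sin (x * Real.sin t)) / Real.cos t ^ 2 := by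
      simp only [hh1]; linarith
    rw [e]
    refine (abs_sub _ _).trans (add_le_add ?_ ?_)
    · have : |Real.sin (x * Real.sin A) * Real.sin A / Real.cos A| ≤ 1 / Real.cos A := by
        rw [abs_div, abs_of_pos hκ, abs_mul]
        gcongr
        exact mul_le_one₀ (Real.abs_sin_le_one _) (abs_nonneg _) (Real.abs_sin_le_one _)
      linarith
    · refine hb.trans (le_of_eq ?_); ring

lemma cos_transform (f f1 f2 : ℝ → ℝ) (a b s : ℝ) (hs : |s| < 1)
    (h1 : ∀ x, 0 < x → HasDerivAt f (f1 x) x) (h2 : ∀ x, 0 < x → HasDerivAt f1 (f2 x) x)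
    (ode : ∀ x, 0 < x → x * f2 x + f1 x + x * f x = 0)
    (hlim : Tendsto (fun x => f x - a * Real.log x) (nhdsWithin 0 (Set.Ioi 0)) (nhds b)) :
    Tendsto (fun T => ∫ x in (0:ℝ)..T, f x * Real.cos (s * x)) atTop
      (nhds ((b + a * (Real.log 2 - Real.eulerMascheroniConstant)) / Real.sqrt (1 - s ^ 2))) := by
  obtain ⟨hs1, hs2⟩ := abs_lt.1 hs
  set A := Real.arcsin s with hAdef
  have hsin : Real.sin A = s := Real.sin_arcsin hs1.le hs2.le
  have hcos : Real.cos A = Real.sqrt (1 - s ^ 2) := Real.cos_arcsin s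
  have hA : |A| < π / 2 := by
    rw [abs_lt]
    exact ⟨Real.neg_pi_div_two_lt_arcsin.2 hs1, Real.arcsin_lt_pi_div_two.2 hs2⟩
  have hκ : 0 < Real.cos A := (cos_ge A hA A Set.right_mem_uIcc).1
  have hh0 : Tendsto (hh A) (nhdsWithin 0 (Set.Ioi 0)) (nhds 0) := by
    have := (hh_deriv A 0).continuousAt.tendsto.mono_left (nhdsWithin_le_nhds (s := Set.Ioi 0))
    simpa [hh] using this
  have key := pairing f f1 f2 (fun x => LL 0 x - hh A x) (fun x => -LL 1 x - hh1 A x)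
    (fun x => LL 2 x - hh2 A x) (fun x => Real.cos A * Real.cos (x * Real.sin A)) a b
    (Real.log 2 - Real.eulerMascheroniConstant)
    (1 + (1 / Real.cos A + 1 + |A| / Real.cos A ^ 2)) h1 h2 ode hlim
    (fun x hx => (LL_deriv 0 x hx).sub (hh_deriv A x))
    (fun x hx => by
      have := (LL_deriv 1 x hx).fun_neg.fun_sub (hh1_deriv A x)
      simpa using this)
    (by fun_prop)
    (fun x hx => by
      have e1 := LL_ode x hx
      have e2 := hh_ode A x
      linear_combination e1 - e2)
    (by
      have := LL_lim.sub hh0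
      rw [sub_zero] at this
      refine this.congr fun x => ?_
      ring)
    (fun x hx => by
      have hx0 : 0 < x := lt_of_lt_of_le one_pos hx
      rw [mul_sub]
      refine (abs_sub _ _).trans (add_le_add ?_ (hh_bound A x hA).1)
      rw [abs_of_nonneg (mul_nonneg hx0.le (LL_nonneg 0 x))]
      have h := mul_le_mul_of_nonneg_left (LL_le 0 x hx0) hx0.le
      refine h.trans (le_of_eq ?_)
      simp [hx0.ne'])
    (fun x hx => by
      have hx0 : 0 < x := lt_of_lt_of_le one_pos hx
      rw [mul_sub]
      refine (abs_sub _ _).trans (add_le_add ?_ (hh_bound A x hA).2)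
      rw [mul_neg, abs_neg, abs_of_nonneg (mul_nonneg hx0.le (LL_nonneg 1 x))]
      have h := mul_le_mul_of_nonneg_left (LL_le 1 x hx0) hx0.le
      refine h.trans ?_
      have e : x * ((1 / x) ^ (1 + 1) * ((Nat.factorial 1 : ℕ) : ℝ)) = 1 / x := by
        simp; field_simp
      rw [e, div_le_one hx0]
      exact hx)
  rw [hcos, hsin] at key
  rw [hcos] at hκ
  have := key.div_const (Real.sqrt (1 - s ^ 2))
  refine this.congr fun T => ?_
  rw [← intervalIntegral.integral_div]
  refine intervalIntegral.integral_congr fun x _ => ?_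
  rw [mul_comm x s]
  field_simp

lemma toC (f : ℝ → ℝ) (T : ℝ) (h : IntervalIntegrable f volume 0 T) :
    IntervalIntegrable (fun x => ((f x : ℝ) : ℂ)) volume 0 T :=
  ⟨h.1.ofReal, h.2.ofReal⟩

/-- Rescaled version. -/
lemma cos_transform_scaled (f f1 f2 : ℝ → ℝ) (a b k ξ : ℝ) (hk : 0 < k) (hξ : |ξ| < k)
    (h1 : ∀ x, 0 < x → HasDerivAt f (f1 x) x) (h2 : ∀ x, 0 < x → HasDerivAt f1 (f2 x) x)
    (ode : ∀ x, 0 < x → x * f2 x + f1 x + x * f x = 0)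
    (hlim : Tendsto (fun x => f x - a * Real.log x) (nhdsWithin 0 (Set.Ioi 0)) (nhds b)) :
    Tendsto (fun T => ∫ x in (0:ℝ)..T, f (k * x) * Real.cos (ξ * x)) atTop
      (nhds ((b + a * (Real.log 2 - Real.eulerMascheroniConstant)) /
        Real.sqrt (k ^ 2 - ξ ^ 2))) := by
  have hs : |ξ / k| < 1 := by rw [abs_div, abs_of_pos hk, div_lt_one hk]; exact hξ
  have h := cos_transform f f1 f2 a b (ξ / k) hs h1 h2 ode hlim
  have h3 := (h.comp (tendsto_id.const_mul_atTop hk)).const_mul k⁻¹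
  have e : Real.sqrt (k ^ 2 - ξ ^ 2) = k * Real.sqrt (1 - (ξ / k) ^ 2) := by
    have : k ^ 2 - ξ ^ 2 = k ^ 2 * (1 - (ξ / k) ^ 2) := by field_simp
    rw [this, Real.sqrt_mul (sq_nonneg k), Real.sqrt_sq hk.le]
  rw [e]
  have e2 : (b + a * (Real.log 2 - Real.eulerMascheroniConstant)) /
      (k * Real.sqrt (1 - (ξ / k) ^ 2)) =
      k⁻¹ * ((b + a * (Real.log 2 - Real.eulerMascheroniConstant)) /
        Real.sqrt (1 - (ξ / k) ^ 2)) := by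
    rw [← div_div, div_right_comm, div_eq_inv_mul]
  rw [e2]
  refine h3.congr fun T => ?_
  have h4 := intervalIntegral.integral_comp_mul_left (a := 0) (b := T)
    (fun y => f y * Real.cos (ξ / k * y)) hk.ne'
  simp only [Function.comp, id]
  rw [mul_zero, smul_eq_mul] at h4
  rw [← h4]
  refine intervalIntegral.integral_congr fun x _ => ?_
  congr 2
  field_simp

/-- **Principal symbol of the 2D Helmholtz single-layer operator.**
For real `ξ` with `|ξ| < k`, `k > 0`, the improper oscillatory integral
`∫_ℝ (i/4) H₀⁽¹⁾(k|x|) e^{iξx} dx` (understood as the limit of symmetric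
truncations) equals `i / (2√(k² − ξ²))`.  Here `H₀⁽¹⁾ = J₀ + iY₀` is the Hankel
function of the first kind of order zero: `J₀` and `Y₀` are characterized as
solutions of the Bessel equation of order zero with the standard
normalizations (`J₀(0) = 1`, `J₀′(0) = 0`, and
`Y₀(x) − (2/π)(log(x/2) + γ)J₀(x) → 0` as `x → 0⁺`). -/
theorem singleLayer_principal_symbol
    (J₀ Y₀ : ℝ → ℝ)
    (hJ₀smooth : ContDiff ℝ (⊤ : ℕ∞) J₀)
    (hJ₀ode : ∀ x : ℝ, x ^ 2 * deriv (deriv J₀) x + x * deriv J₀ x + x ^ 2 * J₀ x = 0)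
    (hJ₀zero : J₀ 0 = 1) (hJ₀'zero : deriv J₀ 0 = 0)
    (hY₀smooth : ContDiffOn ℝ (⊤ : ℕ∞) Y₀ (Set.Ioi 0))
    (hY₀ode : ∀ x ∈ Set.Ioi (0:ℝ),
      x ^ 2 * deriv (deriv Y₀) x + x * deriv Y₀ x + x ^ 2 * Y₀ x = 0)
    (hY₀norm : Tendsto
      (fun x : ℝ => Y₀ x - (2 / π) * (Real.log (x / 2) + Real.eulerMascheroniConstant) * J₀ x)
      (nhdsWithin 0 (Set.Ioi 0)) (nhds 0))
    (k ξ : ℝ) (hk : 0 < k) (hξ : |ξ| < k) :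
    Tendsto
      (fun T : ℝ => ∫ x in (-T)..T,
        (Complex.I / 4) * ((J₀ (k * |x|) : ℂ) + Complex.I * (Y₀ (k * |x|) : ℂ)) *
          Complex.exp (Complex.I * ξ * x))
      atTop
      (nhds (Complex.I / (2 * (Real.sqrt (k ^ 2 - ξ ^ 2) : ℂ)))) := by
  have hJd : Differentiable ℝ J₀ := hJ₀smooth.differentiable (by simp)
  have hJd' : Differentiable ℝ (deriv J₀) := by
    have : ContDiff ℝ 1 (deriv J₀) := by
      have h2 : ContDiff ℝ (1 + 1) J₀ := by
        exact_mod_cast contDiff_infty.1 hJ₀smooth 2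
      exact (contDiff_succ_iff_deriv.1 h2).2.2
    exact this.differentiable (by simp)
  have hYat : ∀ x : ℝ, 0 < x → HasDerivAt Y₀ (deriv Y₀ x) x := fun x hx =>
    ((hY₀smooth.differentiableOn (by simp)).differentiableAt (Ioi_mem_nhds hx)).hasDerivAt
  have hYat' : ∀ x : ℝ, 0 < x → HasDerivAt (deriv Y₀) (deriv (deriv Y₀) x) x := by
    intro x hx
    have h2 : ContDiffOn ℝ (1 + 1) Y₀ (Set.Ioi 0) := by
      exact_mod_cast contDiffOn_infty.1 hY₀smooth 2
    have h3 := ((contDiffOn_succ_iff_deriv_of_isOpen isOpen_Ioi).1 h2).2.2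
    exact ((h3.differentiableOn (by simp)).differentiableAt (Ioi_mem_nhds hx)).hasDerivAt
  have odeJ : ∀ x : ℝ, 0 < x → x * deriv (deriv J₀) x + deriv J₀ x + x * J₀ x = 0 := by
    intro x hx
    have := hJ₀ode x
    apply mul_left_cancel₀ hx.ne'
    linarith
  have odeY : ∀ x : ℝ, 0 < x → x * deriv (deriv Y₀) x + deriv Y₀ x + x * Y₀ x = 0 := by
    intro x hx
    have := hY₀ode x hx
    apply mul_left_cancel₀ hx.ne'
    linarith
  have limJ0 : Tendsto J₀ (nhdsWithin 0 (Set.Ioi 0)) (nhds 1) := by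
    have := (hJd.continuous.tendsto 0).mono_left (nhdsWithin_le_nhds (s := Set.Ioi 0))
    rwa [hJ₀zero] at this
  have limJ : Tendsto (fun x => J₀ x - 0 * Real.log x) (nhdsWithin 0 (Set.Ioi 0)) (nhds 1) := by
    simpa using limJ0
  have limJlog : Tendsto (fun x => Real.log x * (J₀ x - 1)) (nhdsWithin 0 (Set.Ioi 0)) (nhds 0) := by
    have h1 := (hJd 0).hasDerivAt.tendsto_slope_zero_right
    have h2 := (Real.continuous_mul_log.tendsto 0).mono_left (nhdsWithin_le_nhds (s := Set.Ioi 0))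
    have h3 := h2.mul h1
    simp only [zero_add, zero_mul, hJ₀zero, smul_eq_mul] at h3
    refine h3.congr' ?_
    filter_upwards [self_mem_nhdsWithin] with x hx
    have hx : 0 < x := hx
    field_simp
  have limY : Tendsto (fun x => Y₀ x - (2 / π) * Real.log x) (nhdsWithin 0 (Set.Ioi 0))
      (nhds ((2 / π) * (Real.eulerMascheroniConstant - Real.log 2))) := by
    have h := (hY₀norm.add (limJlog.const_mul (2 / π))).add
      (limJ0.const_mul ((2 / π) * (Real.eulerMascheroniConstant - Real.log 2)))
    simp only [mul_zero, zero_add, mul_one] at h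
    refine h.congr' ?_
    filter_upwards [self_mem_nhdsWithin] with x hx
    have hx : 0 < x := hx
    rw [Real.log_div hx.ne' two_ne_zero]
    ring
  have TJ := cos_transform_scaled J₀ _ _ 0 1 k ξ hk hξ (fun x _ => (hJd x).hasDerivAt)
    (fun x _ => (hJd' x).hasDerivAt) odeJ limJ
  have TY := cos_transform_scaled Y₀ _ _ (2 / π)
    ((2 / π) * (Real.eulerMascheroniConstant - Real.log 2)) k ξ hk hξ hYat hYat' odeY limY
  have eY : (2 / π) * (Real.eulerMascheroniConstant - Real.log 2) +
      2 / π * (Real.log 2 - Real.eulerMascheroniConstant) = 0 := by ring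
  rw [eY, zero_div] at TY
  rw [zero_mul, add_zero] at TJ
  have TJc := (Complex.continuous_ofReal.tendsto _).comp TJ
  have TYc := (Complex.continuous_ofReal.tendsto _).comp TY
  have TT := (TJc.add (TYc.const_mul Complex.I)).const_mul (Complex.I / 2)
  have eV : Complex.I / 2 * (((1 / Real.sqrt (k ^ 2 - ξ ^ 2) : ℝ) : ℂ) + Complex.I * ((0:ℝ) : ℂ)) =
      Complex.I / (2 * (Real.sqrt (k ^ 2 - ξ ^ 2) : ℂ)) := by
    push_cast
    rw [mul_zero, add_zero, div_mul_div_comm, mul_one]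
  rw [eV] at TT
  refine TT.congr' ?_
  filter_upwards [eventually_gt_atTop 0] with T hT
  have iJ : IntervalIntegrable (fun x => J₀ (k * x)) volume 0 T :=
    (hJd.continuous.comp (continuous_const.mul continuous_id)).intervalIntegrable _ _
  have iY : IntervalIntegrable (fun x => Y₀ (k * x)) volume 0 T := by
    have h := integrable_near Y₀ _ _ (fun x hx => (hYat x hx).continuousAt) limY (k * T)
      (mul_pos hk hT)
    have h2 := h.comp_mul_left (c := k)
    simpa [hk.ne'] using h2
  have iJc : IntervalIntegrable (fun x => ((J₀ (k * x) : ℝ) : ℂ)) volume 0 T := toC _ _ iJ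
  have iYc : IntervalIntegrable (fun x => ((Y₀ (k * x) : ℝ) : ℂ)) volume 0 T := toC _ _ iY
  have iF : ∀ η : ℝ, IntervalIntegrable (fun x : ℝ => (Complex.I / 4) *
      ((J₀ (k * x) : ℂ) + Complex.I * (Y₀ (k * x) : ℂ)) * Complex.exp (Complex.I * η * x))
      volume 0 T := by
    intro η
    refine IntervalIntegrable.mul_continuousOn ?_ (by fun_prop)
    exact (iJc.add (iYc.const_mul Complex.I)).const_mul _
  set F : ℝ → ℂ := fun x => (Complex.I / 4) *
    ((J₀ (k * |x|) : ℂ) + Complex.I * (Y₀ (k * |x|) : ℂ)) * Complex.exp (Complex.I * ξ * x) with hF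
  have iF1 : IntervalIntegrable F volume 0 T := by
    refine (iF ξ).congr fun x hx => ?_
    rw [Set.uIoc_of_le hT.le] at hx
    simp only [hF, abs_of_pos hx.1]
  have iF2 : IntervalIntegrable (fun x => F (-x)) volume 0 T := by
    refine (iF (-ξ)).congr fun x hx => ?_
    rw [Set.uIoc_of_le hT.le] at hx
    simp only [hF, abs_neg, abs_of_pos hx.1]
    push_cast
    congr 2
    ring
  have iF3 : IntervalIntegrable F volume (-T) 0 := by
    have h := (IntervalIntegrable.iff_comp_neg (f := fun x => F (-x)) (a := 0) (b := T)).1 iF2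
    simp only [neg_neg, neg_zero] at h
    exact h.symm
  have e1 : ∫ x in (-T)..T, F x = ∫ x in (0:ℝ)..T, (F (-x) + F x) := by
    rw [← intervalIntegral.integral_add_adjacent_intervals iF3 iF1,
      intervalIntegral.integral_add iF2 iF1, intervalIntegral.integral_comp_neg, neg_zero]
  have iJcos : IntervalIntegrable (fun x => J₀ (k * x) * Real.cos (ξ * x)) volume 0 T :=
    iJ.mul_continuousOn (by fun_prop)
  have iYcos : IntervalIntegrable (fun x => Y₀ (k * x) * Real.cos (ξ * x)) volume 0 T :=
    iY.mul_continuousOn (by fun_prop)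
  rw [e1]
  simp only [Function.comp]
  rw [← intervalIntegral.integral_ofReal, ← intervalIntegral.integral_ofReal,
    ← intervalIntegral.integral_const_mul, ← intervalIntegral.integral_add (toC _ _ iJcos)
      (IntervalIntegrable.const_mul (toC _ _ iYcos) _),
    ← intervalIntegral.integral_const_mul]
  refine intervalIntegral.integral_congr_ae (Eventually.of_forall fun x hx => ?_)
  rw [Set.uIoc_of_le hT.le] at hx
  simp only [hF, abs_neg, abs_of_pos hx.1]
  push_cast
  have ec : Complex.cos (ξ * x) = (Complex.exp (Complex.I * ξ * x) +
      Complex.exp (Complex.I * ξ * (-x))) / 2 := by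
    rw [Complex.cos]
    congr 3
    · ring
    · ring
  rw [ec]
  ring
end

section
/- For real ξ with |ξ| < k and k > 0, the integral −∫_ℝ (ik/4) (H₁⁽¹⁾(k|x|)/|x|) e^{iξx} dx equals −(i/2)√(k² − ξ²), where H₁⁽¹⁾ is the Hankel function of the first kind of order one, the integral being understood in the distributional/regularized sense. -/
open Real Complex Filter MeasureTheory
open scoped Topology

namespace HypSing

lemma energy_decay (y y1 : ℝ → ℝ)
    (d0 : ∀ x > 0, HasDerivAt y (y1 x) x)
    (d1 : ∀ x > 0, HasDerivAt y1 (-(y1 x) / x - y x) x) (δ : ℝ) (hδ : 0 < δ) :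
    ∃ C : ℝ, 0 ≤ C ∧ ∀ x ≥ δ, |y x| ≤ C * x ^ (-(1/2) : ℝ) ∧ |y1 x| ≤ C * x ^ (-(1/2) : ℝ) := by
  set E : ℝ → ℝ := fun x => x * (y x ^ 2 + y1 x ^ 2) + y x * y1 x + y x ^ 2 / (2 * x) with hE
  have dE : ∀ x > 0, HasDerivAt E (-(y x ^ 2) / (2 * x ^ 2)) x := by
    intro x hx
    have h0 := d0 x hx
    have h1 := d1 x hx
    have hi := hasDerivAt_id x
    have := ((hi.mul ((h0.pow 2).add (h1.pow 2))).add (h0.mul h1)).add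
      ((h0.pow 2).div (hi.const_mul 2) (by simpa using hx.ne'))
    convert! this using 1
    simp only [id]
    simp
    field_simp
    ring
  have anti : AntitoneOn E (Set.Ici δ) := by
    apply antitoneOn_of_deriv_nonpos (convex_Ici δ)
    · intro x hx
      exact (dE x (lt_of_lt_of_le hδ hx)).continuousAt.continuousWithinAt
    · intro x hx
      rw [interior_Ici] at hx
      exact (dE x (hδ.trans hx)).differentiableAt.differentiableWithinAt
    · intro x hx
      rw [interior_Ici] at hx
      rw [(dE x (hδ.trans hx)).deriv]
      have : 0 ≤ y x ^ 2 / (2 * x ^ 2) := by positivity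
      rw [neg_div]; linarith
  have low : ∀ x > 0, x / 2 * (y x ^ 2 + y1 x ^ 2) ≤ E x := by
    intro x hx
    have : E x - x / 2 * (y x ^ 2 + y1 x ^ 2) =
      x / 2 * y x ^ 2 + (x * y1 x + y x) ^ 2 / (2 * x) := by
      simp only [hE]; field_simp; ring
    have h2 : 0 ≤ x / 2 * y x ^ 2 + (x * y1 x + y x) ^ 2 / (2 * x) := by positivity
    linarith
  have E0 : 0 ≤ E δ := le_trans (by positivity) (low δ hδ)
  refine ⟨√(2 * E δ), Real.sqrt_nonneg _, fun x hx => ?_⟩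
  have hx0 : 0 < x := lt_of_lt_of_le hδ hx
  have hle : x / 2 * (y x ^ 2 + y1 x ^ 2) ≤ E δ := (low x hx0).trans (anti Set.self_mem_Ici hx hx)
  have hr : x ^ (-(1/2) : ℝ) = (√x)⁻¹ := by
    rw [Real.rpow_neg hx0.le, Real.sqrt_eq_rpow]
  have hs : 0 < √x := Real.sqrt_pos.2 hx0
  have key : ∀ a : ℝ, x * a ^ 2 ≤ 2 * E δ → |a| ≤ √(2 * E δ) * x ^ (-(1/2) : ℝ) := by
    intro a ha
    rw [hr, ← div_eq_mul_inv, le_div_iff₀ hs]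
    apply Real.le_sqrt_of_sq_le
    rw [mul_pow, sq_abs, Real.sq_sqrt hx0.le]; linarith
  refine ⟨key _ ?_, key _ ?_⟩
  · nlinarith [mul_nonneg hx0.le (sq_nonneg (y1 x))]
  · nlinarith [mul_nonneg hx0.le (sq_nonneg (y x))]

lemma integral_log_exp :
    ∫ t : ℝ in Set.Ioi 0, ((Real.log t * Real.exp (-t) : ℝ) : ℂ) =
      -(Real.eulerMascheroniConstant : ℂ) := by
  have h1 := Complex.hasDerivAt_GammaIntegral (s := 1) (by simp)
  have h2 : HasDerivAt Complex.Gamma (∫ t : ℝ in Set.Ioi 0, (t : ℂ) ^ ((1 : ℂ) - 1) * (Real.log t * Real.exp (-t))) 1 := by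
    apply h1.congr_of_eventuallyEq
    have : ∀ᶠ s : ℂ in 𝓝 1, 0 < s.re :=
      (isOpen_lt continuous_const Complex.continuous_re).mem_nhds (by simp)
    filter_upwards [this] with s hs
    exact Complex.Gamma_eq_integral hs
  have h3 := h2.unique Complex.hasDerivAt_Gamma_one
  rw [← h3]
  apply setIntegral_congr_fun measurableSet_Ioi
  intro t ht
  simp

lemma integrable_log_exp :
    IntegrableOn (fun t : ℝ => Real.log t * Real.exp (-t)) (Set.Ioi 0) := by
  have h : IntegrableOn (fun t : ℝ => ((Real.log t * Real.exp (-t) : ℝ) : ℂ)) (Set.Ioi 0) := by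
    by_contra hc
    have := integral_undef hc
    rw [integral_log_exp] at this
    have h2 := Real.one_half_lt_eulerMascheroniConstant
    rw [neg_eq_zero, Complex.ofReal_eq_zero] at this
    linarith
  have h' := h.re
  exact h'

structure HK (h h1 : ℝ → ℂ) (b : ℂ) : Prop where
  bdef : b = 2 * I / π
  d0 : ∀ x > 0, HasDerivAt h (h1 x) x
  d1 : ∀ x > 0, HasDerivAt h1 (-(h1 x) / x - h x) x
  asym : Tendsto (fun x : ℝ => h x - 1 -
    b * ((Real.log (x / 2) + Real.eulerMascheroniConstant : ℝ) : ℂ)) (𝓝[>] 0) (𝓝 0)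
  dec : ∀ δ > 0, ∃ C : ℝ, 0 ≤ C ∧ ∀ x ≥ δ,
    ‖h x‖ ≤ C * x ^ (-(1/2) : ℝ) ∧ ‖h1 x‖ ≤ C * x ^ (-(1/2) : ℝ)

variable {h h1 : ℝ → ℂ} {b : ℂ}

lemma HK.contOn (H : HK h h1 b) : ContinuousOn h (Set.Ioi 0) :=
  fun x hx => (H.d0 x hx).continuousAt.continuousWithinAt

lemma HK.contOn1 (H : HK h h1 b) : ContinuousOn h1 (Set.Ioi 0) :=
  fun x hx => (H.d1 x hx).continuousAt.continuousWithinAt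

lemma tendsto_sqrt_mul_log (c : ℝ) : Tendsto (fun x : ℝ => x ^ (1/2 : ℝ) * (Real.log (x / 2) + c))
    (𝓝[>] 0) (𝓝 0) := by
  have h1 : Tendsto (fun x : ℝ => Real.log x * x ^ (1/2 : ℝ)) (𝓝[>] 0) (𝓝 0) :=
    tendsto_log_mul_rpow_nhdsGT_zero (by norm_num)
  have h2 : Tendsto (fun x : ℝ => x ^ (1/2 : ℝ)) (𝓝[>] 0) (𝓝 0) := by
    have : Continuous (fun x : ℝ => x ^ (1/2 : ℝ)) := Real.continuous_rpow_const (by norm_num)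
    have := this.tendsto 0
    rw [Real.zero_rpow (by norm_num)] at this
    exact this.mono_left nhdsWithin_le_nhds
  have h3 := h1.add (h2.mul_const (c - Real.log 2))
  simp only [zero_mul, add_zero] at h3
  refine h3.congr' ?_
  filter_upwards [self_mem_nhdsWithin] with x hx
  rw [Real.log_div (ne_of_gt hx) (by norm_num)]; ring

lemma HK.sqrt_mul (H : HK h h1 b) :
    Tendsto (fun x : ℝ => ((x ^ (1/2 : ℝ) : ℝ) : ℂ) * h x) (𝓝[>] 0) (𝓝 0) := by
  have h2 : Tendsto (fun x : ℝ => ((x ^ (1/2 : ℝ) : ℝ) : ℂ)) (𝓝[>] 0) (𝓝 0) := by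
    have : Continuous (fun x : ℝ => x ^ (1/2 : ℝ)) := Real.continuous_rpow_const (by norm_num)
    have := (Complex.continuous_ofReal.comp this).tendsto 0
    simp only [Function.comp_apply, Real.zero_rpow (by norm_num : (1/2 : ℝ) ≠ 0)] at this
    exact this.mono_left nhdsWithin_le_nhds
  have h3 := (Complex.continuous_ofReal.tendsto 0).comp
    (tendsto_sqrt_mul_log Real.eulerMascheroniConstant)
  have h4 := ((h2.mul H.asym).add h2).add (h3.const_mul b)
  simp only [Complex.ofReal_zero, mul_zero, add_zero] at h4
  refine h4.congr fun x => ?_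
  simp only [Function.comp_apply]
  push_cast
  ring

/-- Global bound. -/
lemma HK.bound (H : HK h h1 b) : ∃ C : ℝ, 0 ≤ C ∧ ∀ x > 0, ‖h x‖ ≤ C * x ^ (-(1/2) : ℝ) := by
  have h1 := H.sqrt_mul.norm
  rw [norm_zero] at h1
  have h2 := h1.eventually (gt_mem_nhds one_pos)
  rw [eventually_nhdsWithin_iff, Metric.eventually_nhds_iff] at h2
  obtain ⟨δ, hδ, h2⟩ := h2
  obtain ⟨C, hC, h3⟩ := H.dec (δ / 2) (by positivity)
  refine ⟨C + 1, by positivity, fun x hx => ?_⟩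
  have hp : 0 < x ^ (-(1/2) : ℝ) := Real.rpow_pos_of_pos hx _
  rcases le_total (δ / 2) x with hh | hh
  · have := (h3 x hh).1
    nlinarith
  · have h4 := h2 (y := x) (by rw [dist_zero_right, Real.norm_of_nonneg hx.le]; linarith) hx
    rw [norm_mul, Complex.norm_real, Real.norm_of_nonneg (by positivity)] at h4
    have h5 : x ^ (1/2 : ℝ) * x ^ (-(1/2) : ℝ) = 1 := by
      rw [← Real.rpow_add hx]; norm_num
    have h6 : ‖h x‖ ≤ x ^ (-(1/2) : ℝ) := by
      calc ‖h x‖ = (x ^ (1/2 : ℝ) * ‖h x‖) * x ^ (-(1/2) : ℝ) := by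
            linear_combination (-‖h x‖) * h5
        _ ≤ 1 * x ^ (-(1/2) : ℝ) := by gcongr
        _ = _ := one_mul _
    nlinarith

lemma HK.near_zero (H : HK h h1 b) :
    ∃ K : ℝ, 0 ≤ K ∧ ∀ x : ℝ, x > 0 → x ≤ 1 → ‖(x : ℂ) * h1 x - b‖ ≤ K * x ^ (1/2 : ℝ) * x := by
  obtain ⟨C, hC, hb⟩ := H.bound
  have bd : ∀ x : ℝ, x > 0 → ∀ t : ℝ, t > 0 → t ≤ x → ‖(t : ℂ) * h t‖ ≤ C * x ^ (1/2 : ℝ) := by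
    intro x hx t ht htx
    rw [norm_mul, Complex.norm_real, Real.norm_of_nonneg ht.le]
    calc t * ‖h t‖ ≤ t * (C * t ^ (-(1/2) : ℝ)) := by gcongr; exact hb t ht
      _ = C * (t ^ (1 : ℝ) * t ^ (-(1/2) : ℝ)) := by rw [Real.rpow_one]; ring
      _ = C * t ^ (1/2 : ℝ) := by rw [← Real.rpow_add ht]; norm_num
      _ ≤ C * x ^ (1/2 : ℝ) := by gcongr
  have cont : ContinuousOn (fun t : ℝ => (t : ℂ) * h t) (Set.Ioi 0) :=
    Complex.continuous_ofReal.continuousOn.mul H.contOn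
  have int : ∀ x : ℝ, x > 0 → IntervalIntegrable (fun t : ℝ => (t : ℂ) * h t) volume 0 x := by
    intro x hx
    rw [intervalIntegrable_iff_integrableOn_Ioc_of_le hx.le]
    refine IntegrableOn.of_bound (by simp) ?_ (C * x ^ (1/2 : ℝ)) ?_
    · exact (cont.mono (fun t ht => ht.1)).aestronglyMeasurable measurableSet_Ioc
    · exact (ae_restrict_iff' measurableSet_Ioc).2 (ae_of_all _ fun t ht => bd x hx t ht.1 ht.2)
  set G : ℝ → ℂ := fun x => (x : ℂ) * h1 x with hG
  have dG : ∀ x : ℝ, x > 0 → HasDerivAt G (-((x : ℂ) * h x)) x := by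
    intro x hx
    have := (hasDerivAt_id x).ofReal_comp.mul (H.d1 x hx)
    convert! this using 1
    have : (x : ℂ) ≠ 0 := by exact_mod_cast hx.ne'
    simp
    field_simp
    ring
  set c : ℂ := G 1 + ∫ t in (0 : ℝ)..1, (t : ℂ) * h t with hc
  have Gc : ∀ x : ℝ, x > 0 → x ≤ 1 → ‖G x - c‖ ≤ C * x ^ (1/2 : ℝ) * x := by
    intro x hx hx1
    have e1 : ∫ t in x..1, -((t : ℂ) * h t) = G 1 - G x := by
      apply intervalIntegral.integral_eq_sub_of_hasDerivAt
      · intro t ht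
        rw [Set.uIcc_of_le hx1] at ht
        exact dG t (hx.trans_le ht.1)
      · exact ((int x hx).symm.trans (int 1 one_pos)).neg
    have e2 := intervalIntegral.integral_add_adjacent_intervals (int x hx)
      ((int x hx).symm.trans (int 1 one_pos))
    rw [intervalIntegral.integral_neg] at e1
    have e3 : G x - c = -∫ t in (0 : ℝ)..x, (t : ℂ) * h t := by
      rw [hc, ← e2]; linear_combination (1 : ℂ) * e1
    rw [e3, norm_neg]
    have := intervalIntegral.norm_integral_le_of_norm_le_const (a := 0) (b := x)
      (f := fun t : ℝ => (t : ℂ) * h t) (C := C * x ^ (1/2 : ℝ)) (by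
        intro t ht
        rw [Set.uIoc_of_le hx.le] at ht
        exact bd x hx t ht.1 ht.2)
    rwa [sub_zero, abs_of_pos hx] at this
  -- identify c = b
  have cb : c = b := by
    set D : ℝ → ℂ := fun x => h x - c * (Real.log x : ℂ) with hD
    have dD : ∀ x : ℝ, x > 0 → HasDerivAt D (h1 x - c * ((x⁻¹ : ℝ) : ℂ)) x := fun x hx =>
      (H.d0 x hx).sub ((Real.hasDerivAt_log hx.ne').ofReal_comp.const_mul c)
    have Dbd : ∀ x : ℝ, x > 0 → x ≤ 1 → ‖D x - D 1‖ ≤ C := by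
      intro x hx hx1
      have := Convex.norm_image_sub_le_of_norm_hasDerivWithin_le (f := D)
        (f' := fun x => h1 x - c * ((x⁻¹ : ℝ) : ℂ)) (C := C) (s := Set.Icc x 1)
        (fun t ht => (dD t (hx.trans_le ht.1)).hasDerivWithinAt) (fun t ht => ?_) (convex_Icc x 1)
        (Set.right_mem_Icc.2 hx1) (Set.left_mem_Icc.2 hx1)
      · refine this.trans ?_
        have : ‖x - 1‖ ≤ 1 := by
          rw [Real.norm_eq_abs, abs_le]; constructor <;> linarith
        nlinarith
      · have ht0 : 0 < t := hx.trans_le ht.1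
        have e : (h1 t - c * ((t⁻¹ : ℝ) : ℂ)) = (G t - c) * ((t⁻¹ : ℝ) : ℂ) := by
          have : (t : ℂ) ≠ 0 := by exact_mod_cast ht0.ne'
          simp only [hG]
          push_cast
          field_simp
        rw [e, norm_mul, Complex.norm_real, norm_inv, Real.norm_of_nonneg ht0.le,
          ← div_eq_mul_inv, div_le_iff₀ ht0]
        refine (Gc t ht0 ht.2).trans ?_
        have : t ^ (1/2 : ℝ) ≤ 1 := Real.rpow_le_one ht0.le ht.2 (by norm_num)
        gcongr
        nlinarith
    by_contra hne
    have hpos : 0 < ‖c - b‖ := norm_pos_iff.2 (sub_ne_zero.2 hne)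
    -- bounded
    have ev1 := H.asym.norm.eventually (gt_mem_nhds (show ‖(0:ℂ)‖ < 1 by simp))
    have ev2 : ∀ᶠ x : ℝ in 𝓝[>] 0, x < 1 :=
      nhdsWithin_le_nhds (gt_mem_nhds one_pos)
    set M : ℝ := 1 + ‖(1 : ℂ) + b * ((Real.eulerMascheroniConstant - Real.log 2 : ℝ) : ℂ)‖
      + C + ‖D 1‖ with hM
    have ev3 := (Real.tendsto_log_nhdsGT_zero).eventually (eventually_lt_atBot (-(M / ‖c - b‖)))
    obtain ⟨x, ⟨⟨h1x, h2x⟩, h3x⟩, hx⟩ := ((ev1.and ev2).and ev3 |>.and self_mem_nhdsWithin).exists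
    have hx : 0 < x := hx
    have e : (c - b) * (Real.log x : ℂ) =
      (h x - 1 - b * ((Real.log (x / 2) + Real.eulerMascheroniConstant : ℝ) : ℂ))
      + ((1 : ℂ) + b * ((Real.eulerMascheroniConstant - Real.log 2 : ℝ) : ℂ))
      - (D x - D 1) - D 1 := by
      rw [Real.log_div hx.ne' (by norm_num)]
      simp only [hD]
      push_cast
      ring
    have n1 : ‖(c - b) * (Real.log x : ℂ)‖ ≤ M := by
      rw [e]
      refine (norm_sub_le _ _).trans (add_le_add ((norm_sub_le _ _).trans
        (add_le_add ((norm_add_le _ _).trans (add_le_add h1x.le le_rfl)) (Dbd x hx h2x.le))) le_rfl)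
    rw [norm_mul, Complex.norm_real, Real.norm_eq_abs] at n1
    have n2 : M / ‖c - b‖ < |Real.log x| := by
      have := neg_le_abs (Real.log x); linarith
    rw [div_lt_iff₀ hpos] at n2
    linarith [mul_comm ‖c - b‖ |Real.log x|]
  refine ⟨C, hC, fun x hx hx1 => ?_⟩
  rw [← cb]
  exact Gc x hx hx1

/-- Laplace transform. -/
noncomputable def Lap (h : ℝ → ℂ) (p : ℂ) : ℂ := ∫ x : ℝ in Set.Ioi 0, h x * cexp (-p * x)

lemma norm_exp_neg_mul (p : ℂ) (x : ℝ) : ‖cexp (-p * x)‖ = Real.exp (-p.re * x) := by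
  rw [Complex.norm_exp]; simp

lemma dom_int {a s : ℝ} (C : ℝ) (ha : 0 < a) (hs : -1 < s) :
    IntegrableOn (fun x : ℝ => C * (x ^ s * Real.exp (-a * x))) (Set.Ioi 0) := by
  have := (integrableOn_rpow_mul_exp_neg_mul_rpow hs one_pos ha).const_mul C
  unfold IntegrableOn
  simpa using this

lemma cont_exp (p : ℂ) : Continuous (fun x : ℝ => cexp (-p * x)) := by fun_prop

lemma HK.int0 (H : HK h h1 b) {p : ℂ} (hp : 0 < p.re) :
    IntegrableOn (fun x : ℝ => h x * cexp (-p * x)) (Set.Ioi 0) := by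
  obtain ⟨C, hC, hb⟩ := H.bound
  refine Integrable.mono' (dom_int (s := -(1/2)) C hp (by norm_num)) ?_ ?_
  · exact (H.contOn.mul (cont_exp p).continuousOn).aestronglyMeasurable measurableSet_Ioi
  · refine (ae_restrict_iff' measurableSet_Ioi).2 (ae_of_all _ fun x hx => ?_)
    rw [norm_mul, norm_exp_neg_mul, ← mul_assoc]
    gcongr
    exact hb x hx

lemma HK.bound_mul (H : HK h h1 b) : ∃ C : ℝ, 0 ≤ C ∧ ∀ x : ℝ, x > 0 →
    ‖(x : ℂ) * h x‖ ≤ C * x ^ (1/2 : ℝ) := by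
  obtain ⟨C, hC, hb⟩ := H.bound
  refine ⟨C, hC, fun t ht => ?_⟩
  rw [norm_mul, Complex.norm_real, Real.norm_of_nonneg ht.le]
  calc t * ‖h t‖ ≤ t * (C * t ^ (-(1/2) : ℝ)) := by gcongr; exact hb t ht
    _ = C * (t ^ (1 : ℝ) * t ^ (-(1/2) : ℝ)) := by rw [Real.rpow_one]; ring
    _ = C * t ^ (1/2 : ℝ) := by rw [← Real.rpow_add ht]; norm_num

lemma HK.lap_deriv (H : HK h h1 b) {p : ℂ} (hp : 0 < p.re) :
    IntegrableOn (fun x : ℝ => -((x : ℂ) * h x) * cexp (-p * x)) (Set.Ioi 0) ∧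
    HasDerivAt (Lap h) (∫ x : ℝ in Set.Ioi 0, -((x : ℂ) * h x) * cexp (-p * x)) p := by
  obtain ⟨C, hC, hb⟩ := H.bound_mul
  have hs : {z : ℂ | p.re / 2 < z.re} ∈ 𝓝 p :=
    (isOpen_lt continuous_const Complex.continuous_re).mem_nhds (by simp; linarith)
  refine hasDerivAt_integral_of_dominated_loc_of_deriv_le
    (F := fun (z : ℂ) (x : ℝ) => h x * cexp (-z * x))
    (F' := fun (z : ℂ) (x : ℝ) => -((x : ℂ) * h x) * cexp (-z * x))
    (bound := fun x : ℝ => C * (x ^ (1/2 : ℝ) * Real.exp (-(p.re / 2) * x))) hs ?_ (H.int0 hp) ?_ ?_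
    (dom_int C (by positivity) (by norm_num)) ?_
  · exact Eventually.of_forall fun z =>
      (H.contOn.mul (cont_exp z).continuousOn).aestronglyMeasurable measurableSet_Ioi
  · exact (((Complex.continuous_ofReal.continuousOn.mul H.contOn).neg).mul
      (cont_exp p).continuousOn).aestronglyMeasurable measurableSet_Ioi
  · refine (ae_restrict_iff' measurableSet_Ioi).2 (ae_of_all _ fun x hx z hz => ?_)
    have hx : 0 < x := hx
    have hz : p.re / 2 < z.re := hz
    rw [norm_mul, norm_exp_neg_mul, norm_neg, ← mul_assoc]
    gcongr
    exact hb x hx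
  · refine ae_of_all _ fun x z _ => ?_
    have := (((hasDerivAt_id z).neg.mul_const (x : ℂ)).cexp).const_mul (h x)
    convert! this using 1
    simp
    ring

lemma HK.lap_ode (H : HK h h1 b) {p : ℂ} (hp : 0 < p.re) :
    p * Lap h p + (1 + p ^ 2) * (∫ x : ℝ in Set.Ioi 0, -((x : ℂ) * h x) * cexp (-p * x)) = -b := by
  set Φ : ℝ → ℂ := fun x => cexp (-p * x) * ((x : ℂ) * h1 x + p * ((x : ℂ) * h x)) with hΦ
  set Φ' : ℝ → ℂ := fun x => p * (h x * cexp (-p * x)) +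
    (1 + p ^ 2) * (-((x : ℂ) * h x) * cexp (-p * x)) with hΦ'
  have dΦ : ∀ x : ℝ, x > 0 → HasDerivAt Φ (Φ' x) x := by
    intro x hx
    have hi := (hasDerivAt_id x).ofReal_comp
    have he := (hi.const_mul (-p)).cexp
    have := he.mul ((hi.mul (H.d1 x hx)).add ((hi.mul (H.d0 x hx)).const_mul p))
    convert! this using 1
    have : (x : ℂ) ≠ 0 := by exact_mod_cast hx.ne'
    simp [hΦ']
    field_simp
    ring
  have i0 := H.int0 hp
  have i1 := (H.lap_deriv hp).1
  have iΦ' : IntegrableOn Φ' (Set.Ioi 0) := (i0.const_mul p).add (i1.const_mul (1 + p ^ 2))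
  have tz : Tendsto Φ (𝓝[>] 0) (𝓝 b) := by
    obtain ⟨K, hK, hk⟩ := H.near_zero
    obtain ⟨C, hC, hb⟩ := H.bound_mul
    have hr : Tendsto (fun x : ℝ => x ^ (1/2 : ℝ)) (𝓝[>] 0) (𝓝 0) := by
      have : Continuous (fun x : ℝ => x ^ (1/2 : ℝ)) := Real.continuous_rpow_const (by norm_num)
      have := this.tendsto 0
      rw [Real.zero_rpow (by norm_num)] at this
      exact this.mono_left nhdsWithin_le_nhds
    have t1 : Tendsto (fun x : ℝ => (x : ℂ) * h1 x - b) (𝓝[>] 0) (𝓝 0) := by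
      have hid : Tendsto (fun x : ℝ => x) (𝓝[>] 0) (𝓝 0) := nhdsWithin_le_nhds
      have hb2 : Tendsto (fun x : ℝ => K * x ^ (1/2 : ℝ) * x) (𝓝[>] 0) (𝓝 0) := by
        simpa using (hr.const_mul K).mul hid
      refine squeeze_zero_norm' ?_ hb2
      have ev2 : ∀ᶠ x : ℝ in 𝓝[>] 0, x < 1 := nhdsWithin_le_nhds (gt_mem_nhds one_pos)
      filter_upwards [ev2, self_mem_nhdsWithin] with x hx hx0
      exact hk x hx0 hx.le
    have t2 : Tendsto (fun x : ℝ => (x : ℂ) * h x) (𝓝[>] 0) (𝓝 0) := by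
      have hb2 : Tendsto (fun x : ℝ => C * x ^ (1/2 : ℝ)) (𝓝[>] 0) (𝓝 0) := by
        simpa using (hr.const_mul C)
      refine squeeze_zero_norm' ?_ hb2
      filter_upwards [self_mem_nhdsWithin] with x hx0
      exact hb x hx0
    have t3 : Tendsto (fun x : ℝ => cexp (-p * x)) (𝓝[>] 0) (𝓝 1) := by
      have := (cont_exp p).tendsto 0
      simp only [Complex.ofReal_zero, mul_zero, Complex.exp_zero] at this
      exact this.mono_left nhdsWithin_le_nhds
    have := t3.mul ((t1.add_const b).add (t2.const_mul p))
    simp only [zero_add, mul_zero, add_zero, one_mul] at this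
    refine this.congr fun x => ?_
    simp only [hΦ]; ring
  have ti : Tendsto Φ atTop (𝓝 0) := by
    obtain ⟨C, hC, hd⟩ := H.dec 1 one_pos
    have hb2 : Tendsto (fun x : ℝ => (C * (1 + ‖p‖)) * (x ^ (1/2 : ℝ) * Real.exp (-p.re * x)))
        atTop (𝓝 0) := by
      simpa using (tendsto_rpow_mul_exp_neg_mul_atTop_nhds_zero (1/2) p.re hp).const_mul
        (C * (1 + ‖p‖))
    refine squeeze_zero_norm' ?_ hb2
    filter_upwards [eventually_ge_atTop 1] with x hx
    have hx0 : 0 < x := by linarith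
    have e : x * x ^ (-(1/2) : ℝ) = x ^ (1/2 : ℝ) := by
      nth_rewrite 1 [← Real.rpow_one x]
      rw [← Real.rpow_add hx0]; norm_num
    obtain ⟨a1, a2⟩ := hd x hx
    simp only [hΦ]
    rw [norm_mul, norm_exp_neg_mul]
    have : ‖(x : ℂ) * h1 x + p * ((x : ℂ) * h x)‖ ≤ (C * (1 + ‖p‖)) * x ^ (1/2 : ℝ) := by
      refine (norm_add_le _ _).trans ?_
      rw [norm_mul, norm_mul, norm_mul, Complex.norm_real, Real.norm_of_nonneg hx0.le]
      calc x * ‖h1 x‖ + ‖p‖ * (x * ‖h x‖)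
          ≤ x * (C * x ^ (-(1/2) : ℝ)) + ‖p‖ * (x * (C * x ^ (-(1/2) : ℝ))) := by gcongr
        _ = (C * (1 + ‖p‖)) * (x * x ^ (-(1/2) : ℝ)) := by ring
        _ = _ := by rw [e]
    calc _ ≤ Real.exp (-p.re * x) * ((C * (1 + ‖p‖)) * x ^ (1/2 : ℝ)) := by gcongr
      _ = _ := by ring
  have main := integral_Ioi_of_hasDerivAt_of_tendsto (a := 0) (f := Function.update Φ 0 b)
    (f' := Φ') (m := 0) ?_ ?_ iΦ' ?_
  · rw [Function.update_self, zero_sub] at main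
    rw [← main, hΦ', integral_add (i0.const_mul p) (i1.const_mul _), integral_const_mul,
      integral_const_mul]
    rfl
  · rw [continuousWithinAt_update_same, Set.Ici_sdiff_left]
    exact tz
  · intro x hx
    refine (dΦ x hx).congr_of_eventuallyEq ?_
    filter_upwards [lt_mem_nhds (show (0:ℝ) < x from hx)] with y hy
    rw [Function.update_of_ne hy.ne']
  · refine ti.congr' ?_
    filter_upwards [eventually_gt_atTop 0] with y hy
    rw [Function.update_of_ne hy.ne']

lemma HK.r_bound (H : HK h h1 b) : ∃ K : ℝ, 0 ≤ K ∧ ∀ x : ℝ, x > 0 → ‖h x - 1 -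
    b * ((Real.log (x / 2) + Real.eulerMascheroniConstant : ℝ) : ℂ)‖ ≤ K * (1 + x) := by
  have h2 := H.asym.norm.eventually (gt_mem_nhds (show ‖(0:ℂ)‖ < 1 by simp))
  rw [eventually_nhdsWithin_iff, Metric.eventually_nhds_iff] at h2
  obtain ⟨δ, hδ, h2⟩ := h2
  obtain ⟨C, hC, h3⟩ := H.bound
  have hγ : 0 < Real.eulerMascheroniConstant :=
    lt_trans (by norm_num) Real.one_half_lt_eulerMascheroniConstant
  set M : ℝ := C * δ ^ (-(1/2) : ℝ) + 1 + ‖b‖ * (1 + 2 / δ + Real.eulerMascheroniConstant) with hM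
  have hM0 : 0 ≤ M := by positivity
  refine ⟨1 + M, by positivity, fun x hx => ?_⟩
  rcases lt_or_ge x δ with hh | hh
  · have := h2 (y := x) (by rwa [dist_zero_right, Real.norm_of_nonneg hx.le]) hx
    nlinarith
  · have l1 : ‖h x‖ ≤ C * δ ^ (-(1/2) : ℝ) := by
      refine (h3 x hx).trans ?_
      have : x ^ (-(1/2) : ℝ) ≤ δ ^ (-(1/2) : ℝ) :=
        Real.rpow_le_rpow_of_nonpos hδ hh (by norm_num)
      gcongr
    have l2 : |Real.log (x / 2)| ≤ x + 2 / δ := by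
      have a1 := Real.log_le_sub_one_of_pos (show 0 < x / 2 by positivity)
      have a2 := Real.one_sub_inv_le_log_of_pos (show 0 < x / 2 by positivity)
      have a3 : (x / 2)⁻¹ ≤ 2 / δ := by
        rw [inv_div]; gcongr
      have a4 : 0 < 2 / δ := by positivity
      rw [abs_le]; constructor <;> linarith
    have l3 : |Real.log (x / 2) + Real.eulerMascheroniConstant| ≤
        x + 2 / δ + Real.eulerMascheroniConstant := by
      refine (abs_add_le _ _).trans ?_
      rw [abs_of_pos hγ]; linarith
    calc _ ≤ ‖h x‖ + ‖(1:ℂ)‖ + ‖b * ((Real.log (x / 2) + Real.eulerMascheroniConstant : ℝ) : ℂ)‖ :=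
          (norm_sub_le _ _).trans (add_le_add (norm_sub_le _ _) le_rfl)
      _ ≤ C * δ ^ (-(1/2) : ℝ) + 1 + ‖b‖ * (x + 2 / δ + Real.eulerMascheroniConstant) := by
          rw [norm_mul, norm_one, Complex.norm_real, Real.norm_eq_abs]
          gcongr
      _ ≤ (1 + M) * (1 + x) := by
          have : C * δ ^ (-(1/2) : ℝ) + 1 + ‖b‖ * (x + 2 / δ + Real.eulerMascheroniConstant) ≤
            M + ‖b‖ * x := by
            rw [hM]; nlinarith [norm_nonneg b]
          have h5 : ‖b‖ ≤ M := by
            have : 0 ≤ C * δ ^ (-(1/2) : ℝ) := by positivity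
            have : 0 ≤ ‖b‖ * (2 / δ + Real.eulerMascheroniConstant) := by positivity
            rw [hM]; nlinarith
          nlinarith

lemma HK.lap_asym (H : HK h h1 b) :
    Tendsto (fun p : ℝ => (p : ℂ) * Lap h p + b * (Real.log (2 * p) : ℂ)) atTop (𝓝 1) := by
  set r : ℝ → ℂ := fun x => h x - 1 -
    b * ((Real.log (x / 2) + Real.eulerMascheroniConstant : ℝ) : ℂ) with hr
  obtain ⟨K, hK, hrb⟩ := H.r_bound
  have rcont : ContinuousOn r (Set.Ioi 0) := by
    refine (H.contOn.sub continuousOn_const).sub (continuousOn_const.mul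
      (Complex.continuous_ofReal.comp_continuousOn (ContinuousOn.add ?_ continuousOn_const)))
    refine ContinuousOn.log (continuousOn_id.div_const 2) fun x hx => ?_
    have hx : 0 < x := hx
    simp [hx.ne']
  have ie : IntegrableOn (fun w : ℝ => Real.exp (-w)) (Set.Ioi 0) := integrableOn_exp_neg_Ioi 0
  have iex : IntegrableOn (fun w : ℝ => K * (1 + w) * Real.exp (-w)) (Set.Ioi 0) := by
    have := dom_int (a := 1) (s := 1) 1 one_pos (by norm_num)
    have := (ie.add this).const_mul K
    refine this.congr (ae_of_all _ fun w => ?_)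
    simp
    ring
  have meas : ∀ p : ℝ, 0 < p → AEStronglyMeasurable (fun w : ℝ => r (w / p) * (Real.exp (-w) : ℂ))
      (volume.restrict (Set.Ioi 0)) := by
    intro p hp
    refine ContinuousOn.aestronglyMeasurable (ContinuousOn.mul ?_ ?_) measurableSet_Ioi
    · exact rcont.comp (continuousOn_id.div_const p) fun w hw => div_pos hw hp
    · fun_prop
  have bd : ∀ p : ℝ, 1 ≤ p → ∀ᵐ w ∂(volume.restrict (Set.Ioi 0)),
      ‖r (w / p) * (Real.exp (-w) : ℂ)‖ ≤ K * (1 + w) * Real.exp (-w) := by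
    intro p hp
    refine (ae_restrict_iff' measurableSet_Ioi).2 (ae_of_all _ fun w hw => ?_)
    have hw : 0 < w := hw
    rw [norm_mul, Complex.norm_real, Real.norm_of_nonneg (Real.exp_pos _).le]
    gcongr
    refine (hrb (w / p) (by positivity)).trans ?_
    have : w / p ≤ w := div_le_self hw.le hp
    gcongr
  have lim : Tendsto (fun p : ℝ => ∫ w : ℝ in Set.Ioi 0, r (w / p) * (Real.exp (-w) : ℂ))
      atTop (𝓝 0) := by
    have := tendsto_integral_filter_of_dominated_convergence (l := atTop)
      (μ := volume.restrict (Set.Ioi (0:ℝ)))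
      (F := fun (p : ℝ) (w : ℝ) => r (w / p) * (Real.exp (-w) : ℂ)) (f := fun _ => (0:ℂ))
      (fun w : ℝ => K * (1 + w) * Real.exp (-w)) ?_ ?_ iex ?_
    · simpa using this
    · filter_upwards [eventually_gt_atTop 0] with p hp using meas p hp
    · filter_upwards [eventually_ge_atTop 1] with p hp using bd p hp
    · refine (ae_restrict_iff' measurableSet_Ioi).2 (ae_of_all _ fun w hw => ?_)
      have hw : 0 < w := hw
      have t1 : Tendsto (fun p : ℝ => w / p) atTop (𝓝[>] 0) := by
        refine tendsto_nhdsWithin_iff.2 ⟨tendsto_const_nhds.div_atTop tendsto_id, ?_⟩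
        filter_upwards [eventually_gt_atTop 0] with p hp
        exact div_pos hw hp
      have t2 := (H.asym.comp t1).mul_const ((Real.exp (-w) : ℝ) : ℂ)
      rw [zero_mul] at t2
      exact t2
  have ev : ∀ p : ℝ, 1 ≤ p → (p : ℂ) * Lap h p + b * (Real.log (2 * p) : ℂ) =
      1 + ∫ w : ℝ in Set.Ioi 0, r (w / p) * (Real.exp (-w) : ℂ) := by
    intro p hp
    have hp0 : 0 < p := by linarith
    have e1 := integral_comp_mul_left_Ioi' (fun w : ℝ => h (w / p) * (Real.exp (-w) : ℂ)) 0 hp0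
    have e2 : (p : ℂ) * Lap h p = ∫ w : ℝ in Set.Ioi 0, h (w / p) * (Real.exp (-w) : ℂ) := by
      rw [mul_zero] at e1
      rw [← e1, Lap, Complex.real_smul]
      congr 1
      refine setIntegral_congr_fun measurableSet_Ioi fun x hx => ?_
      rw [mul_div_cancel_left₀ _ hp0.ne']
      push_cast
      congr 2; ring
    have e3 : ∫ w : ℝ in Set.Ioi 0, h (w / p) * (Real.exp (-w) : ℂ) =
      ∫ w : ℝ in Set.Ioi 0, (((1 + b * ((Real.eulerMascheroniConstant - Real.log (2 * p) : ℝ) : ℂ)) *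
        (Real.exp (-w) : ℂ) + b * ((Real.log w * Real.exp (-w) : ℝ) : ℂ)) +
        r (w / p) * (Real.exp (-w) : ℂ)) := by
      refine setIntegral_congr_fun measurableSet_Ioi fun w hw => ?_
      have hw : 0 < w := hw
      simp only [hr]
      rw [div_div, Real.log_div hw.ne' (by positivity), mul_comm p 2]
      push_cast
      ring
    have ieC : IntegrableOn (fun w : ℝ => (Real.exp (-w) : ℂ)) (Set.Ioi 0) := ie.ofReal
    have ilC : IntegrableOn (fun w : ℝ => ((Real.log w * Real.exp (-w) : ℝ) : ℂ)) (Set.Ioi 0) :=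
      integrable_log_exp.ofReal
    have irC : IntegrableOn (fun w : ℝ => r (w / p) * (Real.exp (-w) : ℂ)) (Set.Ioi 0) :=
      Integrable.mono' iex (meas p hp0) (bd p hp)
    have e4 : ∫ w : ℝ in Set.Ioi 0, (Real.exp (-w) : ℂ) = 1 := by
      rw [integral_complex_ofReal, integral_exp_neg_Ioi_zero]; simp
    have i12 : IntegrableOn (fun w : ℝ =>
        (1 + b * ((Real.eulerMascheroniConstant - Real.log (2 * p) : ℝ) : ℂ)) *
        (Real.exp (-w) : ℂ) + b * ((Real.log w * Real.exp (-w) : ℝ) : ℂ)) (Set.Ioi 0) :=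
      (ieC.const_mul _).add (ilC.const_mul _)
    rw [e2, e3, integral_add i12 irC,
      integral_add (ieC.const_mul _) (ilC.const_mul _), integral_const_mul, integral_const_mul,
      integral_log_exp, e4]
    push_cast
    ring
  have := lim.const_add 1
  rw [add_zero] at this
  refine this.congr' ?_
  filter_upwards [eventually_ge_atTop 1] with p hp using (ev p hp).symm

noncomputable def S (p : ℂ) : ℂ := cexp (Complex.log (1 + p ^ 2) / 2)

lemma slit {p : ℂ} (hp : 0 < p.re) : 1 + p ^ 2 ∈ Complex.slitPlane := by
  rw [Complex.mem_slitPlane_iff]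
  by_cases hc : p.im = 0
  · left
    simp [pow_two, hc]
    nlinarith
  · right
    simp [pow_two]
    have : p.re * p.im ≠ 0 := mul_ne_zero hp.ne' hc
    intro h
    apply this
    linarith

lemma S_sq {p : ℂ} (hp : 1 + p ^ 2 ∈ Complex.slitPlane) : S p * S p = 1 + p ^ 2 := by
  rw [S, ← Complex.exp_add, add_halves, Complex.exp_log (Complex.slitPlane_ne_zero hp)]

lemma S_re {p : ℂ} (hp : 1 + p ^ 2 ∈ Complex.slitPlane) : 0 < (S p).re := by
  rw [S, Complex.exp_re]
  refine mul_pos (Real.exp_pos _) (Real.cos_pos_of_mem_Ioo ?_)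
  have h1 := Complex.neg_pi_lt_arg (1 + p ^ 2)
  have h2 := lt_of_le_of_ne (Complex.arg_le_pi (1 + p ^ 2)) (Complex.mem_slitPlane_iff_arg.1 hp).1
  have : (Complex.log (1 + p ^ 2) / 2).im = Complex.arg (1 + p ^ 2) / 2 := by
    rw [show (2:ℂ) = ((2:ℝ):ℂ) by simp, Complex.div_ofReal_im, Complex.log_im]
  rw [this]
  constructor <;> linarith

lemma S_deriv {p : ℂ} (hp : 1 + p ^ 2 ∈ Complex.slitPlane) : HasDerivAt S (p / S p) p := by
  have h1 : HasDerivAt (fun p : ℂ => 1 + p ^ 2) (2 * p) p := by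
    simpa using ((hasDerivAt_id p).pow 2).const_add 1
  have := ((h1.clog hp).div_const 2).cexp
  convert! this using 1
  have hs := S_sq hp
  have h0 : S p ≠ 0 := Complex.exp_ne_zero _
  change p / S p = S p * _
  rw [← hs]
  field_simp

lemma add_S_slit {p : ℂ} (hp : 0 ≤ p.re) (hp2 : 1 + p ^ 2 ∈ Complex.slitPlane) :
    p + S p ∈ Complex.slitPlane := by
  rw [Complex.mem_slitPlane_iff]
  left
  rw [Complex.add_re]
  linarith [S_re hp2]

lemma S_real {p : ℝ} : S (p : ℂ) = ((√(1 + p ^ 2) : ℝ) : ℂ) := by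
  have h0 : 0 < 1 + p ^ 2 := by positivity
  rw [S, ← Complex.ofReal_pow, ← Complex.ofReal_one, ← Complex.ofReal_add,
    ← Complex.ofReal_log h0.le, show (2:ℂ) = ((2:ℝ):ℂ) by simp, ← Complex.ofReal_div,
    ← Complex.ofReal_exp]
  congr 1
  symm
  rw [Real.sqrt_eq_iff_mul_self_eq h0.le (Real.exp_pos _).le, ← Real.exp_add, add_halves,
    Real.exp_log h0]

lemma HK.lap_const (H : HK h h1 b) {p q : ℂ} (hp : 0 < p.re) (hq : 0 < q.re) :
    S p * Lap h p + b * Complex.log (p + S p) = S q * Lap h q + b * Complex.log (q + S q) := by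
  have hD : ∀ z : ℂ, 0 < z.re →
      HasDerivAt (fun z => S z * Lap h z + b * Complex.log (z + S z)) 0 z := by
    intro z hz
    have hz2 := slit hz
    have dS := S_deriv hz2
    have dL := (H.lap_deriv hz).2
    have dlog := ((hasDerivAt_id z).add dS).clog (add_S_slit hz.le hz2)
    have := (dS.mul dL).add (dlog.const_mul b)
    convert! this using 1
    have ode := H.lap_ode hz
    set L' := ∫ x : ℝ in Set.Ioi 0, -((x : ℂ) * h x) * cexp (-z * x)
    have h0 : S z ≠ 0 := Complex.exp_ne_zero _
    have h2 : z + S z ≠ 0 := Complex.slitPlane_ne_zero (add_S_slit hz.le hz2)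
    rw [← S_sq hz2] at ode
    simp only [Pi.add_apply, id]
    field_simp
    linear_combination -(z + S z) * ode
  have ho : IsOpen {z : ℂ | 0 < z.re} := isOpen_lt continuous_const Complex.continuous_re
  have hc : IsPreconnected {z : ℂ | 0 < z.re} := (convex_halfSpace_re_gt 0).isPreconnected
  exact ho.is_const_of_deriv_eq_zero hc
    (fun z hz => (hD z hz).differentiableAt.differentiableWithinAt)
    (fun z hz => (hD z hz).deriv) hp hq

lemma aux_log : Tendsto (fun p : ℝ => Real.log (p + √(1 + p ^ 2)) -
    √(1 + p ^ 2) / p * Real.log (2 * p)) atTop (𝓝 0) ∧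
    Tendsto (fun p : ℝ => √(1 + p ^ 2) / p) atTop (𝓝 1) := by
  have b1 : ∀ p : ℝ, 1 ≤ p → 0 ≤ √(1 + p ^ 2) / p - 1 ∧ √(1 + p ^ 2) / p - 1 ≤ 1 / p ^ 2 := by
    intro p hp
    have hp0 : 0 < p := by linarith
    have h1 : p ≤ √(1 + p ^ 2) := Real.le_sqrt_of_sq_le (by linarith)
    have h2 := Real.sq_sqrt (show 0 ≤ 1 + p ^ 2 by positivity)
    set s := √(1 + p ^ 2)
    constructor
    · rw [sub_nonneg, le_div_iff₀ hp0]; linarith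
    · rw [div_sub_one hp0.ne', div_le_div_iff₀ hp0 (by positivity)]
      have : (s - p) * (s + p) = 1 := by ring_nf; linarith
      nlinarith [mul_nonneg (sub_nonneg.2 h1) hp0.le]
  have t0 : Tendsto (fun p : ℝ => 1 / p ^ 2) atTop (𝓝 0) :=
    tendsto_const_nhds.div_atTop (tendsto_pow_atTop (by norm_num))
  have t1 : Tendsto (fun p : ℝ => √(1 + p ^ 2) / p - 1) atTop (𝓝 0) :=
    squeeze_zero' (by filter_upwards [eventually_ge_atTop 1] with p hp using (b1 p hp).1)
      (by filter_upwards [eventually_ge_atTop 1] with p hp using (b1 p hp).2) t0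
  have t2 : Tendsto (fun p : ℝ => √(1 + p ^ 2) / p) atTop (𝓝 1) := by
    simpa using t1.add_const 1
  have t3 : Tendsto (fun p : ℝ => (√(1 + p ^ 2) / p - 1) * Real.log (2 * p)) atTop (𝓝 0) := by
    have t4 : Tendsto (fun p : ℝ => 2 / p) atTop (𝓝 0) := tendsto_const_nhds.div_atTop tendsto_id
    refine squeeze_zero' ?_ ?_ t4
    · filter_upwards [eventually_ge_atTop 1] with p hp
      exact mul_nonneg (b1 p hp).1 (Real.log_nonneg (by linarith))
    · filter_upwards [eventually_ge_atTop 1] with p hp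
      have hp0 : 0 < p := by linarith
      have h1 := Real.log_le_sub_one_of_pos (show 0 < 2 * p by linarith)
      calc _ ≤ 1 / p ^ 2 * (2 * p) := by
            refine mul_le_mul (b1 p hp).2 (by linarith) (Real.log_nonneg (by linarith))
              (by positivity)
        _ = 2 / p := by field_simp
  refine ⟨?_, t2⟩
  have t5 : Tendsto (fun p : ℝ => Real.log ((1 + √(1 + p ^ 2) / p) / 2)) atTop (𝓝 0) := by
    have : Tendsto (fun p : ℝ => (1 + √(1 + p ^ 2) / p) / 2) atTop (𝓝 1) := by
      have := (t2.const_add 1).div_const 2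
      norm_num at this
      exact this
    have := (Real.continuousAt_log (one_ne_zero)).tendsto.comp this
    rwa [Real.log_one] at this
  have t6 := t5.sub t3
  rw [sub_zero] at t6
  refine t6.congr' ?_
  filter_upwards [eventually_ge_atTop 1] with p hp
  have hp0 : 0 < p := by linarith
  have e : (1 + √(1 + p ^ 2) / p) / 2 = (p + √(1 + p ^ 2)) / (2 * p) := by field_simp
  rw [e, Real.log_div (by positivity) (by positivity)]
  ring

lemma HK.lap_eq (H : HK h h1 b) {p : ℂ} (hp : 0 < p.re) :
    S p * Lap h p + b * Complex.log (p + S p) = 1 := by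
  obtain ⟨t1, t2⟩ := aux_log
  have t1' := (Complex.continuous_ofReal.tendsto _).comp t1
  have t2' := (Complex.continuous_ofReal.tendsto _).comp t2
  have t := (t2'.mul H.lap_asym).add (t1'.const_mul b)
  simp only [Complex.ofReal_one, Complex.ofReal_zero, mul_zero, mul_one, add_zero] at t
  refine tendsto_nhds_unique (tendsto_const_nhds.congr' ?_) t
  filter_upwards [eventually_ge_atTop 1] with q hq
  have hq0 : 0 < q := by linarith
  rw [H.lap_const hp (show 0 < (q : ℂ).re by simpa using hq0), S_real, ← Complex.ofReal_add,
    ← Complex.ofReal_log (by positivity)]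
  have : (q : ℂ) ≠ 0 := by exact_mod_cast hq0.ne'
  simp only [Function.comp_apply]
  push_cast
  field_simp
  ring

noncomputable def Psi (h h1 : ℝ → ℂ) (p : ℂ) (x : ℝ) : ℂ := cexp (-p * x) * (h1 x + p * h x)

noncomputable def Q (h h1 : ℝ → ℂ) (p : ℂ) : ℂ :=
  (1 + p ^ 2) * (∫ x : ℝ in Set.Ioc 0 1, h x * cexp (-p * x))
    - (∫ x : ℝ in Set.Ioi 1, h1 x / x * cexp (-p * x)) + Psi h h1 p 1

lemma HK.dPsi (H : HK h h1 b) (p : ℂ) {x : ℝ} (hx : 0 < x) :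
    HasDerivAt (Psi h h1 p) (-(h1 x / x * cexp (-p * x)) - (1 + p ^ 2) * (h x * cexp (-p * x))) x := by
  have hi := (hasDerivAt_id x).ofReal_comp
  have he := (hi.const_mul (-p)).cexp
  have := he.mul ((H.d1 x hx).add ((H.d0 x hx).const_mul p))
  convert! this using 1
  have : (x : ℂ) ≠ 0 := by exact_mod_cast hx.ne'
  simp
  field_simp
  ring

lemma exp_le_one {p : ℂ} (hp : 0 ≤ p.re) {x : ℝ} (hx : 0 < x) : ‖cexp (-p * x)‖ ≤ 1 := by
  rw [norm_exp_neg_mul, Real.exp_le_one_iff]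
  nlinarith [mul_nonneg hp hx.le]

lemma HK.contA (H : HK h h1 b) (p : ℂ) :
    ContinuousOn (fun x : ℝ => h x * cexp (-p * x)) (Set.Ioi 0) :=
  H.contOn.mul (cont_exp p).continuousOn

lemma HK.contB (H : HK h h1 b) (p : ℂ) :
    ContinuousOn (fun x : ℝ => h1 x / x * cexp (-p * x)) (Set.Ioi 0) := by
  refine ContinuousOn.mul (H.contOn1.div Complex.continuous_ofReal.continuousOn fun x hx => ?_)
    (cont_exp p).continuousOn
  have hx : 0 < x := hx
  exact_mod_cast hx.ne'

lemma HK.domA (H : HK h h1 b) : ∃ g : ℝ → ℝ, IntegrableOn g (Set.Ioc 0 1) ∧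
    ∀ p : ℂ, 0 ≤ p.re → ∀ᵐ x ∂(volume.restrict (Set.Ioc (0:ℝ) 1)), ‖h x * cexp (-p * x)‖ ≤ g x := by
  obtain ⟨C, hC, hb⟩ := H.bound
  refine ⟨fun x => C * x ^ (-(1/2) : ℝ), ?_, fun p hp => ?_⟩
  · have := intervalIntegral.intervalIntegrable_rpow' (a := 0) (b := 1)
      (show (-1 : ℝ) < -(1/2) by norm_num)
    rw [intervalIntegrable_iff_integrableOn_Ioc_of_le zero_le_one] at this
    exact this.const_mul C
  · refine (ae_restrict_iff' measurableSet_Ioc).2 (ae_of_all _ fun x hx => ?_)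
    rw [norm_mul]
    have := exp_le_one hp hx.1
    nlinarith [hb x hx.1, norm_nonneg (h x)]

lemma HK.domB (H : HK h h1 b) : ∃ g : ℝ → ℝ, IntegrableOn g (Set.Ioi 1) ∧
    ∀ p : ℂ, 0 ≤ p.re → ∀ᵐ x ∂(volume.restrict (Set.Ioi (1:ℝ))), ‖h1 x / x * cexp (-p * x)‖ ≤ g x := by
  obtain ⟨C, hC, hb⟩ := H.dec 1 one_pos
  refine ⟨fun x => C * x ^ (-(3/2) : ℝ), ?_, fun p hp => ?_⟩
  · exact (integrableOn_Ioi_rpow_of_lt (by norm_num) one_pos).const_mul C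
  · refine (ae_restrict_iff' measurableSet_Ioi).2 (ae_of_all _ fun x hx => ?_)
    have hx : 1 < x := hx
    have hx0 : 0 < x := by linarith
    have e : x ^ (-(3/2) : ℝ) = x ^ (-(1/2) : ℝ) / x := by
      nth_rewrite 3 [← Real.rpow_one x]
      rw [← Real.rpow_sub hx0]; norm_num
    change _ ≤ C * x ^ (-(3/2) : ℝ)
    rw [norm_mul, norm_div, Complex.norm_real, Real.norm_of_nonneg hx0.le, e]
    have h2 := exp_le_one hp hx0
    calc _ ≤ C * x ^ (-(1/2) : ℝ) / x * 1 := by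
          gcongr
          exact (hb x hx.le).2
      _ = _ := by ring

lemma HK.intA (H : HK h h1 b) {p : ℂ} (hp : 0 ≤ p.re) :
    IntegrableOn (fun x : ℝ => h x * cexp (-p * x)) (Set.Ioc 0 1) := by
  obtain ⟨g, hg, hb⟩ := H.domA
  exact Integrable.mono' hg (((H.contA p).mono (fun t ht => ht.1)).aestronglyMeasurable
    measurableSet_Ioc) (hb p hp)

lemma HK.intB (H : HK h h1 b) {p : ℂ} (hp : 0 ≤ p.re) :
    IntegrableOn (fun x : ℝ => h1 x / x * cexp (-p * x)) (Set.Ioi 1) := by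
  obtain ⟨g, hg, hb⟩ := H.domB
  exact Integrable.mono' hg (((H.contB p).mono (Set.Ioi_subset_Ioi zero_le_one)).aestronglyMeasurable
    measurableSet_Ioi) (hb p hp)

lemma HK.Q_cont (H : HK h h1 b) {p : ℂ} (hp : 0 ≤ p.re) :
    ContinuousWithinAt (Q h h1) {z | 0 ≤ z.re} p := by
  obtain ⟨g, hg, hb⟩ := H.domA
  obtain ⟨g', hg', hb'⟩ := H.domB
  have c1 : ContinuousWithinAt (fun p : ℂ => ∫ x : ℝ in Set.Ioc 0 1, h x * cexp (-p * x))
      {z | 0 ≤ z.re} p := by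
    refine continuousWithinAt_of_dominated (bound := g) ?_ ?_ hg ?_
    · exact Eventually.of_forall fun q => ((H.contA q).mono (fun t ht => ht.1)).aestronglyMeasurable
        measurableSet_Ioc
    · filter_upwards [self_mem_nhdsWithin] with q hq using hb q hq
    · exact ae_of_all _ fun x => Continuous.continuousWithinAt (by fun_prop)
  have c2 : ContinuousWithinAt (fun p : ℂ => ∫ x : ℝ in Set.Ioi 1, h1 x / x * cexp (-p * x))
      {z | 0 ≤ z.re} p := by
    refine continuousWithinAt_of_dominated (bound := g') ?_ ?_ hg' ?_
    · exact Eventually.of_forall fun q => ((H.contB q).mono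
        (Set.Ioi_subset_Ioi zero_le_one)).aestronglyMeasurable measurableSet_Ioi
    · filter_upwards [self_mem_nhdsWithin] with q hq using hb' q hq
    · exact ae_of_all _ fun x => Continuous.continuousWithinAt (by fun_prop)
  have c3 : ContinuousWithinAt (fun p : ℂ => Psi h h1 p 1) {z | 0 ≤ z.re} p := by
    unfold Psi
    exact Continuous.continuousWithinAt (by fun_prop)
  have c4 : ContinuousWithinAt (fun p : ℂ => 1 + p ^ 2) {z | 0 ≤ z.re} p :=
    Continuous.continuousWithinAt (by fun_prop)
  exact ((c4.mul c1).sub c2).add c3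

lemma HK.Q_eq (H : HK h h1 b) {p : ℂ} (hp : 0 < p.re) :
    Q h h1 p = (1 + p ^ 2) * Lap h p := by
  have i0 := H.int0 hp
  have i1 : IntegrableOn (fun x : ℝ => h x * cexp (-p * x)) (Set.Ioi 1) :=
    i0.mono_set (Set.Ioi_subset_Ioi zero_le_one)
  have iB := H.intB hp.le
  have ti : Tendsto (Psi h h1 p) atTop (𝓝 0) := by
    obtain ⟨C, hC, hd⟩ := H.dec 1 one_pos
    have hb2 : Tendsto (fun x : ℝ => (C * (1 + ‖p‖)) * (x ^ (-(1/2) : ℝ) * Real.exp (-p.re * x)))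
        atTop (𝓝 0) := by
      simpa using (tendsto_rpow_mul_exp_neg_mul_atTop_nhds_zero (-(1/2)) p.re hp).const_mul
        (C * (1 + ‖p‖))
    refine squeeze_zero_norm' ?_ hb2
    filter_upwards [eventually_ge_atTop 1] with x hx
    obtain ⟨a1, a2⟩ := hd x hx
    rw [Psi, norm_mul, norm_exp_neg_mul]
    have : ‖h1 x + p * h x‖ ≤ (C * (1 + ‖p‖)) * x ^ (-(1/2) : ℝ) := by
      refine (norm_add_le _ _).trans ?_
      rw [norm_mul]
      calc ‖h1 x‖ + ‖p‖ * ‖h x‖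
          ≤ C * x ^ (-(1/2) : ℝ) + ‖p‖ * (C * x ^ (-(1/2) : ℝ)) := by gcongr
        _ = _ := by ring
    calc _ ≤ Real.exp (-p.re * x) * ((C * (1 + ‖p‖)) * x ^ (-(1/2) : ℝ)) := by gcongr
      _ = _ := by ring
  have e1 := integral_Ioi_of_hasDerivAt_of_tendsto' (a := 1) (f := Psi h h1 p)
    (fun x hx => H.dPsi p (lt_of_lt_of_le one_pos hx)) (iB.neg.sub (i1.const_mul (1 + p ^ 2))) ti
  have iBn : IntegrableOn (fun x : ℝ => -(h1 x / x * cexp (-p * x))) (Set.Ioi 1) := iB.neg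
  rw [integral_sub iBn (i1.const_mul _), integral_neg, integral_const_mul] at e1
  have e2 : Lap h p = (∫ x : ℝ in Set.Ioc 0 1, h x * cexp (-p * x)) +
      ∫ x : ℝ in Set.Ioi 1, h x * cexp (-p * x) := by
    rw [Lap, ← setIntegral_union (Set.Ioc_disjoint_Ioi le_rfl) measurableSet_Ioi
      (H.intA hp.le) i1, Set.Ioc_union_Ioi_eq_Ioi zero_le_one]
  rw [e2, Q]
  linear_combination e1

lemma HK.Q_val (H : HK h h1 b) {p : ℂ} (hp : 0 ≤ p.re) (hp2 : 1 + p ^ 2 ∈ Complex.slitPlane) :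
    Q h h1 p = S p * (1 - b * Complex.log (p + S p)) := by
  have path : Tendsto (fun t : ℝ => p + t) (𝓝[>] 0) (𝓝 p) := by
    have : Continuous (fun t : ℝ => p + t) := by fun_prop
    have := this.tendsto 0
    simp only [Complex.ofReal_zero, add_zero] at this
    exact this.mono_left nhdsWithin_le_nhds
  have path2 : Tendsto (fun t : ℝ => p + t) (𝓝[>] 0) (𝓝[{z | 0 ≤ z.re}] p) := by
    refine tendsto_nhdsWithin_iff.2 ⟨path, ?_⟩
    filter_upwards [self_mem_nhdsWithin] with t ht
    have ht : 0 < t := ht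
    simp; linarith
  have t1 := (H.Q_cont hp).tendsto.comp path2
  have cS : ContinuousAt S p := (S_deriv hp2).continuousAt
  have c2 : ContinuousAt (fun p => S p * (1 - b * Complex.log (p + S p))) p :=
    cS.mul (continuousAt_const.sub (continuousAt_const.mul
      ((continuousAt_id.add cS).clog (add_S_slit hp hp2))))
  have t2 := c2.tendsto.comp path
  refine tendsto_nhds_unique (t1.congr' ?_) t2
  filter_upwards [self_mem_nhdsWithin] with t ht
  have ht : 0 < t := ht
  have hr : 0 < (p + t : ℂ).re := by simp; linarith
  simp only [Function.comp_apply]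
  rw [H.Q_eq hr, ← S_sq (slit hr), ← H.lap_eq hr]
  ring

lemma HK.Q_sum (H : HK h h1 b) {η : ℝ} (hη : |η| < 1) :
    Q h h1 (I * η) + Q h h1 (-(I * η)) = 2 * (√(1 - η ^ 2) : ℂ) := by
  have h0 : 0 < 1 - η ^ 2 := by
    have := (sq_lt_one_iff_abs_lt_one η).2 hη
    linarith
  have sq1 : (1 : ℂ) + (I * η) ^ 2 = ((1 - η ^ 2 : ℝ) : ℂ) := by
    rw [mul_pow, I_sq]; push_cast; ring
  have sq2 : (1 : ℂ) + (-(I * η)) ^ 2 = ((1 - η ^ 2 : ℝ) : ℂ) := by rw [neg_sq, sq1]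
  have sl : ((1 - η ^ 2 : ℝ) : ℂ) ∈ Complex.slitPlane := Complex.ofReal_mem_slitPlane.2 h0
  have S0 : cexp (Complex.log ((1 - η ^ 2 : ℝ) : ℂ) / 2) = ((√(1 - η ^ 2) : ℝ) : ℂ) := by
    rw [← Complex.ofReal_log h0.le, show (2:ℂ) = ((2:ℝ):ℂ) by simp, ← Complex.ofReal_div,
      ← Complex.ofReal_exp]
    congr 1
    symm
    rw [Real.sqrt_eq_iff_mul_self_eq h0.le (Real.exp_pos _).le, ← Real.exp_add, add_halves,
      Real.exp_log h0]
  have S1 : S (I * η) = ((√(1 - η ^ 2) : ℝ) : ℂ) := by rw [S, sq1, S0]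
  have S2 : S (-(I * η)) = ((√(1 - η ^ 2) : ℝ) : ℂ) := by rw [S, sq2, S0]
  have q1 := H.Q_val (p := I * η) (by simp) (by rw [sq1]; exact sl)
  have q2 := H.Q_val (p := -(I * η)) (by simp) (by rw [sq2]; exact sl)
  rw [q1, q2, S1, S2]
  set s := √(1 - η ^ 2) with hs
  have hs0 : 0 < s := Real.sqrt_pos.2 h0
  have hs2 : s ^ 2 = 1 - η ^ 2 := Real.sq_sqrt h0.le
  have inv : -(I * η) + (s : ℂ) = (I * η + s)⁻¹ := by
    refine eq_inv_of_mul_eq_one_left ?_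
    have : (s : ℂ) ^ 2 = 1 - η ^ 2 := by exact_mod_cast hs2
    linear_combination this - (η : ℂ) ^ 2 * I_sq
  rw [inv, Complex.log_inv]
  · ring
  · intro ha
    rw [Complex.arg_eq_pi_iff] at ha
    have := ha.1
    simp at this
    linarith

lemma HK.lim (H : HK h h1 b) {p : ℂ} (hp : 0 ≤ p.re) {l : Filter ℝ} {a R : ℝ → ℝ}
    (ha : Tendsto a l (𝓝[>] 0)) (hR : Tendsto R l atTop) :
    Tendsto (fun ε => (∫ x in (a ε)..(R ε), h1 x / x * cexp (-p * x)) - Psi h h1 p (a ε)) l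
      (𝓝 (-Q h h1 p)) := by
  have iA : IntervalIntegrable (fun x : ℝ => h x * cexp (-p * x)) volume 0 1 :=
    (intervalIntegrable_iff_integrableOn_Ioc_of_le zero_le_one).2 (H.intA hp)
  have t1 := (intervalIntegral_tendsto_integral_Ioi 1 (H.intB hp) tendsto_id).comp hR
  have t2 : Tendsto (fun ε => ∫ x in (0:ℝ)..(a ε), h x * cexp (-p * x)) l (𝓝 0) := by
    have c := intervalIntegral.continuousOn_primitive_interval (a := 0) (b := 1)
      (f := fun x : ℝ => h x * cexp (-p * x)) (μ := volume) (by
        rw [Set.uIcc_of_le zero_le_one, integrableOn_Icc_iff_integrableOn_Ioc]; exact H.intA hp)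
    have c0 := (c 0 Set.left_mem_uIcc).tendsto
    rw [intervalIntegral.integral_same] at c0
    refine c0.comp ?_
    rw [Set.uIcc_of_le zero_le_one]
    refine ha.mono_right ?_
    rw [← nhdsWithin_Ioc_eq_nhdsGT (zero_lt_one' ℝ)]
    exact nhdsWithin_mono _ Set.Ioc_subset_Icc_self
  have t3 := (t1.sub_const (Psi h h1 p 1)).sub
    ((t2.const_sub (∫ x in (0:ℝ)..1, h x * cexp (-p * x))).const_mul (1 + p ^ 2))
  have e : (∫ x : ℝ in Set.Ioi 1, h1 x / x * cexp (-p * x)) - Psi h h1 p 1 -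
      (1 + p ^ 2) * ((∫ x in (0:ℝ)..1, h x * cexp (-p * x)) - 0) = -Q h h1 p := by
    rw [Q, intervalIntegral.integral_of_le zero_le_one]; ring
  rw [e] at t3
  refine t3.congr' ?_
  have ev1 : ∀ᶠ ε in l, a ε ∈ Set.Ioo (0:ℝ) 1 := ha.eventually (Ioo_mem_nhdsGT one_pos)
  filter_upwards [ev1, hR.eventually (eventually_ge_atTop 1)] with ε h1ε h2ε
  have iB : ∀ u v : ℝ, 0 < u → 0 < v →
      IntervalIntegrable (fun x : ℝ => h1 x / x * cexp (-p * x)) volume u v := by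
    intro u v hu hv
    refine ((H.contB p).mono fun x hx => ?_).intervalIntegrable
    rw [Set.mem_uIcc] at hx
    rcases hx with hx | hx
    · exact hu.trans_le hx.1
    · exact hv.trans_le hx.1
  have iA0 : IntervalIntegrable (fun x : ℝ => h x * cexp (-p * x)) volume 0 (a ε) :=
    iA.mono_set (by
      rw [Set.uIcc_of_le h1ε.1.le, Set.uIcc_of_le zero_le_one]
      exact Set.Icc_subset_Icc_right h1ε.2.le)
  have iA1 := iA0.symm.trans iA
  have s1 := intervalIntegral.integral_add_adjacent_intervals (iB _ _ h1ε.1 one_pos)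
    (iB _ _ one_pos (show 0 < R ε by linarith))
  have s2 := intervalIntegral.integral_add_adjacent_intervals iA0 iA1
  have s3 : ∫ x in (a ε)..1, (-(h1 x / x * cexp (-p * x)) - (1 + p ^ 2) * (h x * cexp (-p * x))) =
      Psi h h1 p 1 - Psi h h1 p (a ε) := by
    apply intervalIntegral.integral_eq_sub_of_hasDerivAt
    · intro x hx
      rw [Set.uIcc_of_le h1ε.2.le] at hx
      exact H.dPsi p (h1ε.1.trans_le hx.1)
    · exact (iB _ _ h1ε.1 one_pos).neg.sub (iA1.const_mul _)
  have iBn : IntervalIntegrable (fun x : ℝ => -(h1 x / x * cexp (-p * x))) volume (a ε) 1 :=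
    (iB _ _ h1ε.1 one_pos).neg
  rw [intervalIntegral.integral_sub iBn (iA1.const_mul _),
    intervalIntegral.integral_neg, intervalIntegral.integral_const_mul] at s3
  simp only [Function.comp_apply, id]
  linear_combination s1 + s3 + (1 + p ^ 2) * s2

lemma HK.psi_sum (H : HK h h1 b) (η : ℝ) :
    Tendsto (fun x : ℝ => Psi h h1 (I * η) x + Psi h h1 (-(I * η)) x - 2 * b / x)
      (𝓝[>] 0) (𝓝 0) := by
  have hr : Tendsto (fun x : ℝ => x ^ (1/2 : ℝ)) (𝓝[>] 0) (𝓝 0) := by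
    have : Continuous (fun x : ℝ => x ^ (1/2 : ℝ)) := Real.continuous_rpow_const (by norm_num)
    have := this.tendsto 0
    rw [Real.zero_rpow (by norm_num)] at this
    exact this.mono_left nhdsWithin_le_nhds
  have t1 : Tendsto (fun x : ℝ => h1 x - b / x) (𝓝[>] 0) (𝓝 0) := by
    obtain ⟨K, hK, hk⟩ := H.near_zero
    have hb2 : Tendsto (fun x : ℝ => K * x ^ (1/2 : ℝ)) (𝓝[>] 0) (𝓝 0) := by
      simpa using hr.const_mul K
    refine squeeze_zero_norm' ?_ hb2
    have ev2 : ∀ᶠ x : ℝ in 𝓝[>] 0, x < 1 := nhdsWithin_le_nhds (gt_mem_nhds one_pos)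
    filter_upwards [ev2, self_mem_nhdsWithin] with x hx hx0
    have hx0 : 0 < x := hx0
    have hc : (x : ℂ) ≠ 0 := by exact_mod_cast hx0.ne'
    have e : h1 x - b / x = ((x : ℂ) * h1 x - b) / x := by field_simp
    rw [e, norm_div, Complex.norm_real, Real.norm_of_nonneg hx0.le, div_le_iff₀ hx0]
    exact hk x hx0 hx.le
  have t2 : Tendsto (fun x : ℝ => (x : ℂ) * h x) (𝓝[>] 0) (𝓝 0) := by
    obtain ⟨C, hC, hb⟩ := H.bound_mul
    have hb2 : Tendsto (fun x : ℝ => C * x ^ (1/2 : ℝ)) (𝓝[>] 0) (𝓝 0) := by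
      simpa using (hr.const_mul C)
    refine squeeze_zero_norm' ?_ hb2
    filter_upwards [self_mem_nhdsWithin] with x hx0
    exact hb x hx0
  have dE : ∀ p : ℂ, HasDerivAt (fun x : ℝ => cexp (-p * x)) (-p) 0 := by
    intro p
    have hi := (hasDerivAt_id (0:ℝ)).ofReal_comp
    have he := (hi.const_mul (-p)).cexp
    convert! he using 1
    simp
  have sl : ∀ (f : ℝ → ℂ) (c : ℂ), HasDerivAt f c 0 →
      Tendsto (fun x : ℝ => (f x - f 0) / x) (𝓝[>] 0) (𝓝 c) := by
    intro f c hf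
    have := (hasDerivAt_iff_tendsto_slope.1 hf).mono_left
      (nhdsWithin_mono 0 (show Set.Ioi (0:ℝ) ⊆ {0}ᶜ from fun x hx => ne_of_gt hx))
    refine this.congr fun x => ?_
    rw [slope_def_module, sub_zero, Complex.real_smul]
    push_cast
    ring
  have s1 := sl _ _ ((dE (I * η)).add (dE (-(I * η))))
  have s2 := sl _ _ ((dE (I * η)).sub (dE (-(I * η))))
  have ce : Tendsto (fun x : ℝ => cexp (-(I * η) * x) + cexp (-(-(I * η)) * x)) (𝓝[>] 0) (𝓝 (1 + 1)) := by
    have : Continuous (fun x : ℝ => cexp (-(I * η) * x) + cexp (-(-(I * η)) * x)) := by fun_prop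
    have := this.tendsto 0
    simp only [Complex.ofReal_zero, mul_zero, Complex.exp_zero] at this
    exact this.mono_left nhdsWithin_le_nhds
  have t := ((t1.mul ce).add (s1.const_mul b)).add ((t2.mul s2).const_mul (I * η))
  simp only [zero_mul, mul_zero, add_zero, zero_add, neg_neg, neg_add_cancel] at t
  refine t.congr' ?_
  filter_upwards [self_mem_nhdsWithin] with x hx0
  have hx0 : 0 < x := hx0
  have hc : (x : ℂ) ≠ 0 := by exact_mod_cast hx0.ne'
  simp only [Psi, Pi.add_apply, Pi.sub_apply, Complex.ofReal_zero, mul_zero, Complex.exp_zero, neg_neg]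
  field_simp
  ring

lemma set_int (f : ℝ → ℂ) (hf : ContinuousOn f {0}ᶜ) {ε : ℝ} (h0 : 0 < ε) (h1 : ε < 1) :
    ∫ x in {y : ℝ | ε < |y| ∧ |y| < ε⁻¹}, f x = ∫ x in ε..ε⁻¹, (f x + f (-x)) := by
  have hinv : 1 < ε⁻¹ := (one_lt_inv₀ h0).2 h1
  have hle : ε ≤ ε⁻¹ := by linarith
  have hset : {y : ℝ | ε < |y| ∧ |y| < ε⁻¹} = Set.Ioo (-ε⁻¹) (-ε) ∪ Set.Ioo ε ε⁻¹ := by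
    ext y
    simp only [Set.mem_setOf_eq, Set.mem_union, Set.mem_Ioo]
    rcases le_total 0 y with hy | hy
    · rw [abs_of_nonneg hy]
      constructor
      · intro h; right; exact h
      · rintro (h | h)
        · linarith
        · exact h
    · rw [abs_of_nonpos hy]
      constructor
      · rintro ⟨h, h'⟩; left; constructor <;> linarith
      · rintro (⟨h, h'⟩ | ⟨h, h'⟩)
        · constructor <;> linarith
        · linarith
  have i1 : IntervalIntegrable f volume ε ε⁻¹ := by
    refine (hf.mono fun x hx => ?_).intervalIntegrable
    rw [Set.uIcc_of_le hle] at hx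
    exact (h0.trans_le hx.1).ne'
  have i2 : IntervalIntegrable f volume (-ε⁻¹) (-ε) := by
    refine (hf.mono fun x hx => ?_).intervalIntegrable
    rw [Set.uIcc_of_le (by linarith)] at hx
    exact (show x < 0 by linarith [hx.2]).ne
  have i3 : IntervalIntegrable (fun x => f (-x)) volume ε ε⁻¹ := by
    refine ContinuousOn.intervalIntegrable (hf.comp continuousOn_neg fun x hx => ?_)
    rw [Set.uIcc_of_le hle] at hx
    exact (show -x < 0 by linarith [hx.1]).ne
  have j1 : IntegrableOn f (Set.Ioo ε ε⁻¹) :=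
    ((intervalIntegrable_iff_integrableOn_Ioc_of_le hle).1 i1).mono_set Set.Ioo_subset_Ioc_self
  have j2 : IntegrableOn f (Set.Ioo (-ε⁻¹) (-ε)) :=
    ((intervalIntegrable_iff_integrableOn_Ioc_of_le (by linarith)).1 i2).mono_set
      Set.Ioo_subset_Ioc_self
  rw [hset, setIntegral_union _ measurableSet_Ioo j2 j1, intervalIntegral.integral_add i1 i3,
    intervalIntegral.integral_comp_neg, ← integral_Ioc_eq_integral_Ioo,
    ← integral_Ioc_eq_integral_Ioo, ← intervalIntegral.integral_of_le hle,
    ← intervalIntegral.integral_of_le (by linarith), add_comm]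
  rw [Set.disjoint_left]
  intro x hx hx'
  linarith [hx.2, hx'.1]

lemma HK.final (H : HK h h1 b) (H₁ : ℝ → ℂ) (hH₁ : ∀ z : ℝ, z > 0 → H₁ z = -h1 z)
    (k ξ : ℝ) (hk : 0 < k) (hξ : |ξ| < k) :
    Tendsto
      (fun ε : ℝ =>
        (∫ x in {y : ℝ | ε < |y| ∧ |y| < ε⁻¹},
          -((Complex.I * k / 4) * (H₁ (k * |x|) / ((|x| : ℝ) : ℂ)) *
            Complex.exp (Complex.I * ξ * x))) + ((1 / (π * ε) : ℝ) : ℂ))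
      (nhdsWithin 0 (Set.Ioi 0))
      (nhds (-(Complex.I / 2) * (Real.sqrt (k ^ 2 - ξ ^ 2) : ℂ))) := by
  have hkC : (k : ℂ) ≠ 0 := by exact_mod_cast hk.ne'
  set η : ℝ := ξ / k with hη
  have hη1 : |η| < 1 := by
    rw [hη, abs_div, abs_of_pos hk, div_lt_one hk]; exact hξ
  have ha : Tendsto (fun ε : ℝ => k * ε) (𝓝[>] 0) (𝓝[>] 0) := by
    refine tendsto_nhdsWithin_iff.2 ⟨?_, ?_⟩
    · have : Continuous (fun ε : ℝ => k * ε) := by fun_prop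
      have := this.tendsto 0
      rw [mul_zero] at this
      exact this.mono_left nhdsWithin_le_nhds
    · filter_upwards [self_mem_nhdsWithin] with ε hε using mul_pos hk hε
  have hR : Tendsto (fun ε : ℝ => k * ε⁻¹) (𝓝[>] 0) atTop :=
    tendsto_inv_nhdsGT_zero.const_mul_atTop hk
  have l1 := H.lim (p := I * η) (by simp) ha hR
  have l2 := H.lim (p := -(I * η)) (by simp) ha hR
  have l3 := (H.psi_sum η).comp ha
  have l := ((l1.add l2).add l3).const_mul (I * k / 4)
  have val : I * k / 4 * (-Q h h1 (I * η) + -Q h h1 (-(I * η)) + 0) =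
      -(Complex.I / 2) * (Real.sqrt (k ^ 2 - ξ ^ 2) : ℂ) := by
    have e : Real.sqrt (k ^ 2 - ξ ^ 2) = k * √(1 - η ^ 2) := by
      rw [show k ^ 2 - ξ ^ 2 = k ^ 2 * (1 - η ^ 2) by rw [hη]; field_simp,
        Real.sqrt_mul (by positivity), Real.sqrt_sq hk.le]
    rw [e]
    push_cast
    linear_combination (-I * k / 4) * H.Q_sum hη1
  rw [val] at l
  refine l.congr' ?_
  have ev : ∀ᶠ x : ℝ in 𝓝[>] 0, x < 1 := nhdsWithin_le_nhds (gt_mem_nhds one_pos)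
  filter_upwards [ev, self_mem_nhdsWithin] with ε hε1 hε0
  have hε0 : 0 < ε := hε0
  have hinv : 1 < ε⁻¹ := (one_lt_inv₀ hε0).2 hε1
  have hle : ε ≤ ε⁻¹ := by linarith
  have hεC : (ε : ℂ) ≠ 0 := by exact_mod_cast hε0.ne'
  set f : ℝ → ℂ := fun x => -((Complex.I * k / 4) * (H₁ (k * |x|) / ((|x| : ℝ) : ℂ)) *
            Complex.exp (Complex.I * ξ * x)) with hf
  set f2 : ℝ → ℂ := fun x => ((Complex.I * k / 4) * (h1 (k * |x|) / ((|x| : ℝ) : ℂ)) *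
            Complex.exp (Complex.I * ξ * x)) with hf2
  have ff : Set.EqOn f f2 {0}ᶜ := by
    intro x hx
    have : 0 < |x| := abs_pos.2 hx
    simp only [hf, hf2]
    rw [hH₁ _ (mul_pos hk this)]
    ring
  have cf2 : ContinuousOn f2 {0}ᶜ := by
    refine ContinuousOn.mul (continuousOn_const.mul (ContinuousOn.div ?_ ?_ ?_)) (by fun_prop)
    · refine H.contOn1.comp (by fun_prop) fun x hx => ?_
      exact mul_pos hk (abs_pos.2 hx)
    · fun_prop
    · intro x hx
      exact_mod_cast (abs_pos.2 hx).ne'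
  have e0 := set_int f (cf2.congr ff) hε0 hε1
  rw [e0]
  have iB : ∀ p : ℂ, IntervalIntegrable (fun x : ℝ => h1 x / x * cexp (-p * x)) volume
      (k * ε) (k * ε⁻¹) := by
    intro p
    refine ((H.contB p).mono fun x hx => ?_).intervalIntegrable
    rw [Set.uIcc_of_le (by gcongr)] at hx
    exact (mul_pos hk hε0).trans_le hx.1
  have e1 : ∫ x in ε..ε⁻¹, (f x + f (-x)) = I * k / 4 *
      ((∫ x in (k * ε)..(k * ε⁻¹), h1 x / x * cexp (-(I * η) * x)) +
       ∫ x in (k * ε)..(k * ε⁻¹), h1 x / x * cexp (-(-(I * η)) * x)) := by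
    rw [← intervalIntegral.integral_add (iB _) (iB _),
      ← intervalIntegral.smul_integral_comp_mul_left
        (fun x : ℝ => h1 x / x * cexp (-(I * η) * x) + h1 x / x * cexp (-(-(I * η)) * x)) k,
      Complex.real_smul, ← mul_assoc, ← intervalIntegral.integral_const_mul]
    refine intervalIntegral.integral_congr fun x hx => ?_
    rw [Set.uIcc_of_le hle] at hx
    have hx0 : 0 < x := hε0.trans_le hx.1
    have hxC : (x : ℂ) ≠ 0 := by exact_mod_cast hx0.ne'
    have a1 := ff (show x ∈ ({0}ᶜ : Set ℝ) from hx0.ne')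
    have a2 := ff (show -x ∈ ({0}ᶜ : Set ℝ) from (neg_lt_zero.2 hx0).ne)
    simp only [a1, a2, hf2, abs_neg, abs_of_pos hx0]
    have m1 : I * (ξ : ℂ) * x = -(-(I * η)) * ((k * x : ℝ) : ℂ) := by
      rw [hη]; push_cast; field_simp
    have m2 : I * (ξ : ℂ) * ((-x : ℝ) : ℂ) = -(I * η) * ((k * x : ℝ) : ℂ) := by
      rw [hη]; push_cast; field_simp
    rw [m1, m2]
    push_cast
    field_simp
    ring
  rw [e1]
  simp only [Function.comp_apply]
  have hπ : (π : ℂ) ≠ 0 := by exact_mod_cast Real.pi_ne_zero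
  have e2 : ((1 / (π * ε) : ℝ) : ℂ) = -(I * k / 4 * (2 * b / ((k * ε : ℝ) : ℂ))) := by
    rw [H.bdef]
    push_cast
    field_simp
    linear_combination (4 : ℂ) * I_sq
  rw [e2]
  ring

end HypSing

namespace HypSing

lemma ode_solve {x a b c : ℝ} (hx : 0 < x) (h : x ^ 2 * a + x * b + x ^ 2 * c = 0) :
    a = -b / x - c := by
  have : x * (x * a + b + x * c) = 0 := by linear_combination h
  have := (mul_eq_zero.1 this).resolve_left hx.ne'
  field_simp
  linear_combination this

lemma mkHK (J₀ Y₀ : ℝ → ℝ)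
    (hJ₀smooth : ContDiff ℝ (⊤ : ℕ∞) J₀)
    (hJ₀ode : ∀ x : ℝ, x ^ 2 * deriv (deriv J₀) x + x * deriv J₀ x + x ^ 2 * J₀ x = 0)
    (hJ₀zero : J₀ 0 = 1) (hJ₀'zero : deriv J₀ 0 = 0)
    (hY₀smooth : ContDiffOn ℝ (⊤ : ℕ∞) Y₀ (Set.Ioi 0))
    (hY₀ode : ∀ x ∈ Set.Ioi (0:ℝ),
      x ^ 2 * deriv (deriv Y₀) x + x * deriv Y₀ x + x ^ 2 * Y₀ x = 0)
    (hY₀norm : Tendsto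
      (fun x : ℝ => Y₀ x - (2 / π) * (Real.log (x / 2) + Real.eulerMascheroniConstant) * J₀ x)
      (nhdsWithin 0 (Set.Ioi 0)) (nhds 0)) :
    HK (fun t => (J₀ t : ℂ) + I * (Y₀ t : ℂ))
      (fun t => ((deriv J₀ t : ℝ) : ℂ) + I * ((deriv Y₀ t : ℝ) : ℂ)) (2 * I / π) := by
  have J0 : ∀ x, HasDerivAt J₀ (deriv J₀ x) x := fun x =>
    (hJ₀smooth.differentiable (by simp) x).hasDerivAt
  have J2 : ContDiff ℝ (1 + 1 : ℕ∞) J₀ := hJ₀smooth.of_le (WithTop.coe_le_coe.2 le_top)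
  have J1 : ∀ x > 0, HasDerivAt (deriv J₀) (-(deriv J₀ x) / x - J₀ x) x := by
    intro x hx
    rw [← ode_solve hx (hJ₀ode x)]
    have : ContDiff ℝ 1 (deriv J₀) := (contDiff_succ_iff_deriv.1 (by exact_mod_cast J2)).2.2
    exact (this.differentiable (by simp) x).hasDerivAt
  have Y0 : ∀ x > 0, HasDerivAt Y₀ (deriv Y₀ x) x := fun x hx =>
    ((hY₀smooth.differentiableOn (by simp)).differentiableAt (Ioi_mem_nhds hx)).hasDerivAt
  have Y1 : ∀ x > 0, HasDerivAt (deriv Y₀) (-(deriv Y₀ x) / x - Y₀ x) x := by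
    intro x hx
    rw [← ode_solve hx (hY₀ode x hx)]
    have : ContDiffOn ℝ 1 (deriv Y₀) (Set.Ioi 0) :=
      hY₀smooth.deriv_of_isOpen isOpen_Ioi (WithTop.coe_le_coe.2 (le_top : (1 + 1 : ℕ∞) ≤ ⊤))
    exact ((this.differentiableOn (by simp)).differentiableAt (Ioi_mem_nhds hx)).hasDerivAt
  refine ⟨rfl, ?_, ?_, ?_, ?_⟩
  · intro x hx
    exact (J0 x).ofReal_comp.add ((Y0 x hx).ofReal_comp.const_mul I)
  · intro x hx
    refine HasDerivAt.congr_deriv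
      ((J1 x hx).ofReal_comp.add ((Y1 x hx).ofReal_comp.const_mul I)) ?_
    push_cast
    ring
  · have tJ : Tendsto (fun x => J₀ x - 1) (𝓝[>] 0) (𝓝 0) := by
      have := (J0 0).continuousAt.tendsto.sub_const 1
      rw [hJ₀zero, sub_self] at this
      exact this.mono_left nhdsWithin_le_nhds
    have ts : Tendsto (fun x : ℝ => x⁻¹ * (J₀ x - 1)) (𝓝[>] 0) (𝓝 0) := by
      have := (hasDerivAt_iff_tendsto_slope_zero.1 (J0 0))
      rw [hJ₀'zero] at this
      have := this.mono_left (nhdsWithin_mono 0 (show Set.Ioi (0:ℝ) ⊆ {0}ᶜ from fun x hx => (Set.mem_Ioi.1 hx).ne'))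
      simpa [hJ₀zero] using this
    have tx : Tendsto (fun x : ℝ => x ^ (1/2:ℝ)) (𝓝[>] 0) (𝓝 0) := by
      have := (Real.continuousAt_rpow_const 0 (1/2:ℝ) (Or.inr (by norm_num))).tendsto
      rw [Real.zero_rpow (by norm_num)] at this
      exact this.mono_left nhdsWithin_le_nhds
    have tL : Tendsto (fun x : ℝ => (Real.log (x/2) + Real.eulerMascheroniConstant) * (J₀ x - 1))
        (𝓝[>] 0) (𝓝 0) := by
      have := (tx.mul (tendsto_sqrt_mul_log Real.eulerMascheroniConstant)).mul ts
      rw [mul_zero] at this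
      refine this.congr' ?_
      filter_upwards [self_mem_nhdsWithin] with x (hx : 0 < x)
      have e : x ^ (1/2:ℝ) * x ^ (1/2:ℝ) = x := by
        rw [← Real.rpow_add hx]; norm_num
      calc _ = (x ^ (1/2:ℝ) * x ^ (1/2:ℝ)) * x⁻¹ *
            ((Real.log (x/2) + Real.eulerMascheroniConstant) * (J₀ x - 1)) := by ring
        _ = _ := by rw [e, mul_inv_cancel₀ hx.ne', one_mul]
    have c : ∀ {f : ℝ → ℝ}, Tendsto f (𝓝[>] 0) (𝓝 0) →
        Tendsto (fun x => (f x : ℂ)) (𝓝[>] 0) (𝓝 0) := by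
      intro f hf
      have := (Complex.continuous_ofReal.tendsto 0).comp hf
      rw [Complex.ofReal_zero] at this
      exact this
    have := ((c tJ).add ((c hY₀norm).const_mul I)).add ((c tL).const_mul (I * (2 / π)))
    rw [mul_zero, mul_zero, add_zero, add_zero] at this
    refine this.congr fun x => ?_
    push_cast
    ring
  · intro δ hδ
    obtain ⟨C, hC, h⟩ := energy_decay _ _ (fun x _ => J0 x) J1 δ hδ
    obtain ⟨D, hD, g⟩ := energy_decay _ _ Y0 Y1 δ hδ
    refine ⟨C + D, add_nonneg hC hD, fun x hx => ⟨?_, ?_⟩⟩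
    · refine (norm_add_le _ _).trans ?_
      rw [norm_mul, Complex.norm_I, one_mul, Complex.norm_real, Complex.norm_real, add_mul]
      exact add_le_add (h x hx).1 (g x hx).1
    · refine (norm_add_le _ _).trans ?_
      rw [norm_mul, Complex.norm_I, one_mul, Complex.norm_real, Complex.norm_real, add_mul]
      exact add_le_add (h x hx).2 (g x hx).2

end HypSing

/-- **Principal symbol of the 2D Helmholtz hypersingular operator.**
For real `ξ` with `|ξ| < k`, `k > 0`, the regularized (Hadamard finite-part)
integral `−∫_ℝ (ik/4)(H₁⁽¹⁾(k|x|)/|x|) e^{iξx} dx` equals `−(i/2)√(k² − ξ²)`.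
Here `H₁⁽¹⁾ = J₁ + iY₁ = −(H₀⁽¹⁾)′` is the Hankel function of the first kind of
order one, with `H₀⁽¹⁾ = J₀ + iY₀` characterized by the Bessel equation of
order zero and the standard normalizations.  The regularized sense is the
finite-part limit: the divergent `1/(πε)` contribution of the non-integrable
`−1/(2πx²)` singularity is subtracted before letting the inner cutoff `ε → 0⁺`
(with outer cutoff `1/ε`). -/
theorem hypersingular_principal_symbol
    (J₀ Y₀ : ℝ → ℝ)
    (hJ₀smooth : ContDiff ℝ (⊤ : ℕ∞) J₀)
    (hJ₀ode : ∀ x : ℝ, x ^ 2 * deriv (deriv J₀) x + x * deriv J₀ x + x ^ 2 * J₀ x = 0)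
    (hJ₀zero : J₀ 0 = 1) (hJ₀'zero : deriv J₀ 0 = 0)
    (hY₀smooth : ContDiffOn ℝ (⊤ : ℕ∞) Y₀ (Set.Ioi 0))
    (hY₀ode : ∀ x ∈ Set.Ioi (0:ℝ),
      x ^ 2 * deriv (deriv Y₀) x + x * deriv Y₀ x + x ^ 2 * Y₀ x = 0)
    (hY₀norm : Tendsto
      (fun x : ℝ => Y₀ x - (2 / π) * (Real.log (x / 2) + Real.eulerMascheroniConstant) * J₀ x)
      (nhdsWithin 0 (Set.Ioi 0)) (nhds 0))
    (H₁ : ℝ → ℂ)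
    (hH₁ : ∀ z : ℝ, H₁ z =
      -deriv (fun t : ℝ => (J₀ t : ℂ) + Complex.I * (Y₀ t : ℂ)) z)
    (k ξ : ℝ) (hk : 0 < k) (hξ : |ξ| < k) :
    Tendsto
      (fun ε : ℝ =>
        (∫ x in {y : ℝ | ε < |y| ∧ |y| < ε⁻¹},
          -((Complex.I * k / 4) * (H₁ (k * |x|) / ((|x| : ℝ) : ℂ)) *
            Complex.exp (Complex.I * ξ * x))) + ((1 / (π * ε) : ℝ) : ℂ))
      (nhdsWithin 0 (Set.Ioi 0))
      (nhds (-(Complex.I / 2) * (Real.sqrt (k ^ 2 - ξ ^ 2) : ℂ))) := by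

  have H := HypSing.mkHK J₀ Y₀ hJ₀smooth hJ₀ode hJ₀zero hJ₀'zero hY₀smooth hY₀ode hY₀norm
  exact H.final H₁ (fun z hz => by rw [hH₁ z, (H.d0 z hz).deriv]) k ξ hk hξ
end
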